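/- arXiv:1909.06807 — 8 statements merged into one kernel-verified Lean document; each statement's English description precedes it below -/
import Mathlib

section
/- Let χ: ℝ⁺ → ℝ be a continuous kernel function satisfying: (i) ∑_{k=-∞}^{+∞} χ(e^{-k} x^w) = 1 for every x ∈ ℝ⁺ and w > 0; (ii) M₂(χ) := sup_{u ∈ ℝ⁺} ∑_{k=-∞}^{+∞} |χ(e^{-k} u)| |k - log u|² < +∞ and lim_{γ→+∞} ∑_{|k - log u| > γ} |χ(e^{-k} u)| |k - log u|² = 0 uniformly with respect to u ∈ ℝ⁺. Let f: ℝ⁺ → ℝ be Lebesgue measurable and bounded. Then for every point x ∈ ℝ⁺ at which f is continuous, lim_{w→∞} (I_w^χ f)(x) = f(x), where (I_w^χ f)(x) = ∑_{k=-∞}^{+∞} χ(e^{-k} x^w) · w ∫_{k/w}^{(k+1)/w} f(e^u) du. -/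
open Real MeasureTheory Filter Topology

/-- The Kantorovich exponential sampling series
`(I_w^χ f)(x) = ∑_{k ∈ ℤ} χ(e^{-k} x^w) · w ∫_{k/w}^{(k+1)/w} f(e^u) du`. -/
noncomputable def kantExp (χ f : ℝ → ℝ) (w x : ℝ) : ℝ :=
  ∑' k : ℤ, χ (Real.exp (-(k : ℝ)) * x ^ w) *
    (w * ∫ u in ((k : ℝ) / w)..(((k : ℝ) + 1) / w), f (Real.exp u))

/-- If `g` stays within `D` of `L` on `[a, a + 1 / w]`, so does its mean over that interval. -/
theorem abs_mul_intervalIntegral_sub_le {g : ℝ → ℝ} {w a b L D : ℝ} (hw : 0 < w)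
    (hab : b - a = 1 / w) (hg : IntervalIntegrable g volume a b)
    (hD : ∀ u, a ≤ u → u ≤ b → |g u - L| ≤ D) :
    |w * (∫ u in a..b, g u) - L| ≤ D := by
  have hle : a ≤ b := by
    have : 0 < 1 / w := by positivity
    linarith
  have h1 : w * (∫ u in a..b, g u) - L = w * ∫ u in a..b, (g u - L) := by
    rw [intervalIntegral.integral_sub hg intervalIntegrable_const,
      intervalIntegral.integral_const, hab, smul_eq_mul]
    field_simp
  have h2 : ‖∫ u in a..b, (g u - L)‖ ≤ D * |b - a| := by
    refine intervalIntegral.norm_integral_le_of_norm_le_const fun u hu => ?_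
    rw [Set.uIoc_of_le hle] at hu
    exact hD u hu.1.le hu.2
  rw [hab, abs_of_pos (by positivity : 0 < 1 / w), Real.norm_eq_abs] at h2
  rw [h1, abs_mul, abs_of_pos hw]
  calc w * |∫ u in a..b, (g u - L)| ≤ w * (D * (1 / w)) := by gcongr
    _ = D := by field_simp

/-- A measurable function on `ℝ⁺` that is bounded there becomes interval integrable after
composition with the exponential. -/
theorem intervalIntegrable_comp_exp_of_bounded {f : ℝ → ℝ} {B : ℝ} (hfm : Measurable f)
    (hB : ∀ x > (0 : ℝ), |f x| ≤ B) (a b : ℝ) :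
    IntervalIntegrable (fun u => f (Real.exp u)) volume a b := by
  refine (intervalIntegrable_const (c := B)).mono_fun
    (hfm.comp Real.measurable_exp).aestronglyMeasurable (Eventually.of_forall fun u => ?_)
  exact (hB _ (Real.exp_pos u)).trans (le_abs_self B)

/-- A kernel continuous on `ℝ⁺` is dominated, uniformly in `u`, by a constant at the two integers
nearest to `log u` and by the terms of its second absolute moment elsewhere. -/
theorem exists_abs_kernel_le {χ : ℝ → ℝ} (hχ : ContinuousOn χ (Set.Ioi 0)) :
    ∃ K : ℝ, 0 ≤ K ∧ ∀ u > (0 : ℝ), ∀ k : ℤ,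
      |χ (Real.exp (-(k : ℝ)) * u)| ≤
        (if k ∈ ({⌊Real.log u⌋, ⌊Real.log u⌋ + 1} : Finset ℤ) then K else 0) +
          |χ (Real.exp (-(k : ℝ)) * u)| * |(k : ℝ) - Real.log u| ^ 2 := by
  obtain ⟨K, hK⟩ := IsCompact.exists_bound_of_continuousOn
    (isCompact_Icc (a := Real.exp (-1)) (b := Real.exp 1))
    (hχ.mono fun y hy => (Real.exp_pos _).trans_le hy.1)
  have hK0 : 0 ≤ K := (norm_nonneg _).trans
    (hK 1 ⟨Real.exp_le_one_iff.2 (by norm_num), Real.one_le_exp (by norm_num)⟩)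
  refine ⟨K, hK0, fun u hu k => ?_⟩
  have hfl := Int.floor_le (Real.log u)
  have hlt := Int.lt_floor_add_one (Real.log u)
  split_ifs with hk
  · have hexp : Real.exp (-(k : ℝ)) * u = Real.exp (Real.log u - k) := by
      rw [sub_eq_neg_add, Real.exp_add, Real.exp_log hu]
    have hbound : |χ (Real.exp (-(k : ℝ)) * u)| ≤ K := by
      rw [hexp]
      simp only [Finset.mem_insert, Finset.mem_singleton] at hk
      refine hK _ ⟨Real.exp_le_exp.2 ?_, Real.exp_le_exp.2 ?_⟩ <;>
        rcases hk with rfl | rfl <;> push_cast <;> linarith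
    exact hbound.trans (le_add_of_nonneg_right (by positivity))
  · have hfar : 1 ≤ |(k : ℝ) - Real.log u| := by
      simp only [Finset.mem_insert, Finset.mem_singleton, not_or] at hk
      rcases lt_or_ge k ⌊Real.log u⌋ with h | h
      · have : (k : ℝ) + 1 ≤ ⌊Real.log u⌋ := by exact_mod_cast h
        exact le_abs.2 (Or.inr (by linarith))
      · have : (⌊Real.log u⌋ : ℝ) + 2 ≤ k := by
          exact_mod_cast (by omega : ⌊Real.log u⌋ + 2 ≤ k)
        exact le_abs.2 (Or.inl (by linarith))
    rw [zero_add]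
    exact le_mul_of_one_le_right (abs_nonneg _) (one_le_pow₀ hfar)

/-- The error of the Kantorovich series at `x` when `f ∘ exp` varies by at most `ε` on the
`δ`-neighbourhood of `log x`. -/
theorem abs_kantExp_sub_le {χ f : ℝ → ℝ} {K C B x w ε δ : ℝ} (hx : 0 < x) (hw : 0 < w)
    (hε : 0 ≤ ε) (hδ : 0 < δ) (hK : 0 ≤ K)
    (hχ1 : HasSum (fun k : ℤ => χ (Real.exp (-(k : ℝ)) * x ^ w)) 1)
    (hdom : ∀ k : ℤ, |χ (Real.exp (-(k : ℝ)) * x ^ w)| ≤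
      (if k ∈ ({⌊Real.log (x ^ w)⌋, ⌊Real.log (x ^ w)⌋ + 1} : Finset ℤ) then K else 0) +
        |χ (Real.exp (-(k : ℝ)) * x ^ w)| * |(k : ℝ) - Real.log (x ^ w)| ^ 2)
    (hsum : Summable (fun k : ℤ =>
      |χ (Real.exp (-(k : ℝ)) * x ^ w)| * |(k : ℝ) - Real.log (x ^ w)| ^ 2))
    (hC : (∑' k : ℤ,
      |χ (Real.exp (-(k : ℝ)) * x ^ w)| * |(k : ℝ) - Real.log (x ^ w)| ^ 2) ≤ C)
    (hfm : Measurable f) (hB : ∀ y > (0 : ℝ), |f y| ≤ B)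
    (hf : ∀ u, |u - Real.log x| < δ → |f (Real.exp u) - f x| ≤ ε) (hwδ : 1 / w < δ / 2) :
    |kantExp χ f w x - f x| ≤ ε * (2 * K) + (ε + 2 * B * (2 / (w * δ)) ^ 2) * C := by
  have hB0 : 0 ≤ B := (abs_nonneg _).trans (hB x hx)
  set t := Real.log (x ^ w) with ht
  have htw : t = w * Real.log x := Real.log_rpow hx w
  set c : ℤ → ℝ := fun k => χ (Real.exp (-(k : ℝ)) * x ^ w) with hc
  set m : ℤ → ℝ := fun k => w * ∫ u in ((k : ℝ) / w)..(((k : ℝ) + 1) / w), f (Real.exp u) with hm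
  set S : Finset ℤ := {⌊t⌋, ⌊t⌋ + 1} with hS
  have hmean (k : ℤ) (D : ℝ)
      (hD : ∀ u, (k : ℝ) / w ≤ u → u ≤ ((k : ℝ) + 1) / w → |f (Real.exp u) - f x| ≤ D) :
      |m k - f x| ≤ D :=
    abs_mul_intervalIntegral_sub_le hw (by ring)
      (intervalIntegrable_comp_exp_of_bounded hfm hB _ _) hD
  have hmB (k : ℤ) : |m k - f x| ≤ 2 * B := by
    refine hmean k _ fun u _ _ => (abs_sub _ _).trans ?_
    linarith [hB _ (Real.exp_pos u), hB x hx]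
  have hterm (k : ℤ) : ‖c k * (m k - f x)‖ ≤ ε * (if k ∈ S then K else 0) +
      (ε + 2 * B * (2 / (w * δ)) ^ 2) * (|c k| * |(k : ℝ) - t| ^ 2) := by
    have hd : |c k| ≤ (if k ∈ S then K else 0) + |c k| * |(k : ℝ) - t| ^ 2 := hdom k
    rw [Real.norm_eq_abs, abs_mul]
    rcases le_or_gt |(k : ℝ) - t| (w * δ / 2) with hnear | hfar
    · have hmε : |m k - f x| ≤ ε := by
        refine hmean k _ fun u hu1 hu2 => hf u ?_
        have h1 := (abs_le.1 hnear)
        have e1 : (k : ℝ) / w - Real.log x = ((k : ℝ) - t) / w := by rw [htw]; field_simp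
        have e2 : ((k : ℝ) + 1) / w = (k : ℝ) / w + 1 / w := by ring
        have h2 : -(δ / 2) ≤ ((k : ℝ) - t) / w := by rw [le_div_iff₀ hw]; linarith
        have h3 : ((k : ℝ) - t) / w ≤ δ / 2 := by rw [div_le_iff₀ hw]; linarith
        rw [abs_lt]
        constructor <;> linarith
      calc |c k| * |m k - f x| ≤ ((if k ∈ S then K else 0) + |c k| * |(k : ℝ) - t| ^ 2) * ε := by
            gcongr
        _ = ε * (if k ∈ S then K else 0) + ε * (|c k| * |(k : ℝ) - t| ^ 2) := by ring
        _ ≤ _ := by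
            gcongr
            exact le_add_of_nonneg_right (by positivity)
    · have h1 : 1 ≤ (2 / (w * δ) * |(k : ℝ) - t|) ^ 2 := by
        refine one_le_pow₀ ?_
        rw [div_mul_eq_mul_div, one_le_div (by positivity)]
        linarith
      have hite : 0 ≤ (if k ∈ S then K else 0) := by split_ifs <;> simp [hK]
      calc |c k| * |m k - f x| ≤ |c k| * (2 * B) * 1 := by
            rw [mul_one]; gcongr; exact hmB k
        _ ≤ |c k| * (2 * B) * (2 / (w * δ) * |(k : ℝ) - t|) ^ 2 := by gcongr
        _ = 2 * B * (2 / (w * δ)) ^ 2 * (|c k| * |(k : ℝ) - t| ^ 2) := by ring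
        _ ≤ (ε + 2 * B * (2 / (w * δ)) ^ 2) * (|c k| * |(k : ℝ) - t| ^ 2) := by
            gcongr
            exact le_add_of_nonneg_left hε
        _ ≤ _ := le_add_of_nonneg_left (by positivity)
  have hSsum : HasSum (fun k : ℤ => if k ∈ S then K else 0) (2 * K) := by
    have h := hasSum_sum_of_ne_finset_zero (L := .unconditional ℤ)
      (f := fun k : ℤ => if k ∈ S then K else 0) (s := S)
      fun k hk => if_neg hk
    have hcard : S.card = 2 := Finset.card_pair (by omega)
    have hval : ∑ k ∈ S, (if k ∈ S then K else 0) = 2 * K := by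
      rw [Finset.sum_congr rfl fun k hk => if_pos hk, Finset.sum_const, hcard, nsmul_eq_mul]
      norm_num
    rwa [hval] at h
  have hbound := (hSsum.mul_left ε).add
    (hsum.hasSum.mul_left (ε + 2 * B * (2 / (w * δ)) ^ 2))
  have hdiff := (Summable.of_norm_bounded hbound.summable hterm).hasSum
  have hkant : HasSum (fun k => c k * m k) ((∑' k, c k * (m k - f x)) + 1 * f x) :=
    (hdiff.add (hχ1.mul_right (f x))).congr_fun fun k => by ring
  have heq : kantExp χ f w x - f x = ∑' k, c k * (m k - f x) := by
    have : kantExp χ f w x = _ := hkant.tsum_eq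
    rw [this]
    ring
  rw [heq]
  refine (tsum_of_norm_bounded hbound hterm).trans ?_
  gcongr

theorem pointwise_convergence_of_kantExp
    (χ f : ℝ → ℝ)
    (hχc : ContinuousOn χ (Set.Ioi 0))
    -- (i) partition of unity
    (hχ1 : ∀ x > (0 : ℝ), ∀ w > (0 : ℝ),
      HasSum (fun k : ℤ => χ (Real.exp (-(k : ℝ)) * x ^ w)) 1)
    -- (ii) M₂(χ) < ∞
    (hM2 : ∃ C : ℝ, ∀ u > (0 : ℝ),
      Summable (fun k : ℤ =>
        |χ (Real.exp (-(k : ℝ)) * u)| * |(k : ℝ) - Real.log u| ^ 2) ∧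
      (∑' k : ℤ, |χ (Real.exp (-(k : ℝ)) * u)| * |(k : ℝ) - Real.log u| ^ 2) ≤ C)
    -- (ii) uniform vanishing of the tails of the second absolute moment
    (htail : ∀ ε > (0 : ℝ), ∃ γ₀ : ℝ, ∀ γ ≥ γ₀, ∀ u > (0 : ℝ),
      (∑' k : {k : ℤ // γ < |(k : ℝ) - Real.log u|},
        |χ (Real.exp (-((k : ℤ) : ℝ)) * u)| * |((k : ℤ) : ℝ) - Real.log u| ^ 2) < ε)
    -- f Lebesgue measurable and bounded
    (hfm : Measurable f)
    (hfb : ∃ B : ℝ, ∀ x > (0 : ℝ), |f x| ≤ B)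
    -- x a point of continuity of f in ℝ⁺
    (x : ℝ) (hx : 0 < x) (hfx : ContinuousWithinAt f (Set.Ioi 0) x) :
    Tendsto (fun w : ℝ => kantExp χ f w x) atTop (nhds (f x)) := by
  obtain ⟨C, hC⟩ := hM2
  obtain ⟨B, hB⟩ := hfb
  obtain ⟨K, hK0, hK⟩ := exists_abs_kernel_le hχc
  have hcont : ContinuousAt (fun u => f (Real.exp u)) (Real.log x) := by
    have hfx' : ContinuousAt f (Real.exp (Real.log x)) := by
      rw [Real.exp_log hx]
      exact hfx.continuousAt (Ioi_mem_nhds hx)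
    exact ContinuousAt.comp hfx' Real.continuous_exp.continuousAt
  have hC0 : 0 ≤ C := (tsum_nonneg fun _ => by positivity).trans (hC 1 one_pos).2
  rw [Metric.tendsto_nhds]
  intro η hη
  set ε := η / (2 * (2 * K + C + 1)) with hε
  have hεpos : 0 < ε := by positivity
  obtain ⟨δ, hδ, hfδ⟩ := Metric.continuousAt_iff.1 hcont ε hεpos
  have hlim : Tendsto (fun w : ℝ => ε * (2 * K) + (ε + 2 * B * (2 / (w * δ)) ^ 2) * C) atTop
      (𝓝 (ε * (2 * K) + (ε + 2 * B * 0 ^ 2) * C)) := by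
    have h0 : Tendsto (fun w : ℝ => 2 / (w * δ)) atTop (𝓝 0) :=
      (tendsto_id.atTop_mul_const hδ).const_div_atTop 2
    exact ((((h0.pow 2).const_mul (2 * B)).const_add ε).mul_const C).const_add _
  have hsmall : ε * (2 * K) + (ε + 2 * B * 0 ^ 2) * C < η := by
    have : ε * (2 * (2 * K + C + 1)) = η := by rw [hε]; field_simp
    nlinarith
  have hinv : Tendsto (fun w : ℝ => 1 / w) atTop (𝓝 0) := tendsto_const_nhds.div_atTop tendsto_id
  filter_upwards [hlim.eventually_lt_const hsmall, hinv.eventually_lt_const (half_pos hδ),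
    eventually_gt_atTop 0] with w hw1 hw2 hw
  have hu : 0 < x ^ w := Real.rpow_pos_of_pos hx w
  refine lt_of_le_of_lt ?_ hw1
  refine abs_kantExp_sub_le hx hw hεpos.le hδ hK0 (hχ1 x hx w hw) (hK _ hu) (hC _ hu).1
    (hC _ hu).2 hfm hB (fun u hu' => ?_) hw2
  have h := hfδ (x := u) hu'
  rw [Real.exp_log hx] at h
  exact h.le
end

section
/- Let χ: ℝ⁺ → ℝ be a continuous kernel function satisfying: (i) ∑_{k=-∞}^{+∞} χ(e^{-k} x^w) = 1 for every x ∈ ℝ⁺ and w > 0; (ii) M₂(χ) < +∞ and lim_{γ→+∞} ∑_{|k - log u| > γ} |χ(e^{-k} u)| |k - log u|² = 0 uniformly with respect to u ∈ ℝ⁺. If f: ℝ⁺ → ℝ is bounded and log-uniformly continuous on ℝ⁺ (i.e., for every ε > 0 there exists δ > 0 such that |f(u) - f(v)| < ε whenever |log u - log v| ≤ δ), then lim_{w→∞} ‖I_w^χ f - f‖_∞ = 0, where ‖·‖_∞ denotes the supremum norm over ℝ⁺. -/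
open Real MeasureTheory Filter Topology

/-- A kernel with finite second absolute moment that is continuous on `ℝ⁺` has finite absolute
moment of order zero. -/
theorem exists_tsum_abs_kernel_le {χ : ℝ → ℝ} (hχc : ContinuousOn χ (Set.Ioi 0))
    (hM2 : ∃ C : ℝ, ∀ u > (0 : ℝ),
      Summable (fun k : ℤ =>
        |χ (Real.exp (-(k : ℝ)) * u)| * |(k : ℝ) - Real.log u| ^ 2) ∧
      (∑' k : ℤ, |χ (Real.exp (-(k : ℝ)) * u)| * |(k : ℝ) - Real.log u| ^ 2) ≤ C) :
    ∃ M : ℝ, ∀ u > (0 : ℝ),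
      Summable (fun k : ℤ => |χ (Real.exp (-(k : ℝ)) * u)|) ∧
      (∑' k : ℤ, |χ (Real.exp (-(k : ℝ)) * u)|) ≤ M := by
  obtain ⟨C, hC⟩ := hM2
  obtain ⟨K, hK⟩ := (isCompact_Icc (a := Real.exp (-1)) (b := Real.exp 1)).exists_bound_of_continuousOn
    (hχc.mono fun x hx => (Real.exp_pos _).trans_le hx.1)
  refine ⟨C + 2 * K, fun u hu => ?_⟩
  obtain ⟨hs, hle⟩ := hC u hu
  have hK0 : 0 ≤ K := (norm_nonneg _).trans
    (hK 1 ⟨Real.exp_le_one_iff.2 (by norm_num), Real.one_le_exp (by norm_num)⟩)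
  set s : Finset ℤ := {⌊Real.log u⌋, ⌊Real.log u⌋ + 1} with hsdef
  have hind : HasSum (fun k : ℤ => if k ∈ s then K else 0) (2 * K) := by
    have h := hasSum_sum_of_ne_finset_zero (f := fun k : ℤ => if k ∈ s then K else 0) (s := s)
      (L := SummationFilter.unconditional ℤ) (fun b hb => if_neg hb)
    have hval : (∑ k ∈ s, if k ∈ s then K else 0) = 2 * K := by
      rw [Finset.sum_ite_mem, Finset.inter_self, Finset.sum_const, hsdef,
        Finset.card_pair (by simp)]
      simp
    rwa [hval] at h
  have hsum := hs.hasSum.add hind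
  have hbound : ∀ k : ℤ, |χ (Real.exp (-(k : ℝ)) * u)| ≤
      |χ (Real.exp (-(k : ℝ)) * u)| * |(k : ℝ) - Real.log u| ^ 2 +
        (if k ∈ s then K else 0) := by
    intro k
    rcases le_or_gt 1 |(k : ℝ) - Real.log u| with h | h
    · have h1 : (1 : ℝ) ≤ |(k : ℝ) - Real.log u| ^ 2 := one_le_pow₀ h
      have h2 : (0 : ℝ) ≤ if k ∈ s then K else 0 := by split_ifs <;> simp [hK0]
      nlinarith [abs_nonneg (χ (Real.exp (-(k : ℝ)) * u))]
    · obtain ⟨hl, hr⟩ := abs_lt.1 h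
      have hk : k ∈ s := by
        have h1 : k < ⌊Real.log u⌋ + 2 := by
          have := Int.lt_floor_add_one (Real.log u)
          have h3 : (k : ℝ) < ((⌊Real.log u⌋ + 2 : ℤ) : ℝ) := by push_cast; linarith
          exact_mod_cast h3
        have h2 : ⌊Real.log u⌋ < k + 1 := by
          have := Int.floor_le (Real.log u)
          have h3 : ((⌊Real.log u⌋ : ℤ) : ℝ) < ((k + 1 : ℤ) : ℝ) := by push_cast; linarith
          exact_mod_cast h3
        simp only [hsdef, Finset.mem_insert, Finset.mem_singleton]
        omega
      rw [if_pos hk]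
      have hexp : Real.exp (-(k : ℝ)) * u = Real.exp (-(k : ℝ) + Real.log u) := by
        rw [Real.exp_add, Real.exp_log hu]
      have hb := hK (Real.exp (-(k : ℝ)) * u) (by
        rw [hexp]
        exact ⟨Real.exp_le_exp.2 (by linarith), Real.exp_le_exp.2 (by linarith)⟩)
      rw [Real.norm_eq_abs] at hb
      have : 0 ≤ |χ (Real.exp (-(k : ℝ)) * u)| * |(k : ℝ) - Real.log u| ^ 2 := by positivity
      linarith
  have hs0 := Summable.of_nonneg_of_le (fun _ => abs_nonneg _) hbound hsum.summable
  exact ⟨hs0, (hasSum_le hbound hs0.hasSum hsum).trans (by linarith)⟩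

/-- The average of `g` over an interval of length `w⁻¹` is within `D` of `c` if `g` is. -/
theorem abs_mul_integral_sub_le {g : ℝ → ℝ} (hg : Continuous g) {a b w c D : ℝ} (hw : 0 < w)
    (hab : b - a = 1 / w) (h : ∀ t ∈ Set.Icc a b, |g t - c| ≤ D) :
    |w * (∫ t in a..b, g t) - c| ≤ D := by
  have hle : a ≤ b := sub_nonneg.1 (hab ▸ by positivity)
  have hsub : w * (∫ t in a..b, g t) - c = w * ∫ t in a..b, (g t - c) := by
    rw [intervalIntegral.integral_sub (hg.intervalIntegrable _ _) intervalIntegrable_const,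
      intervalIntegral.integral_const, hab, smul_eq_mul]
    field_simp
  have hI := intervalIntegral.norm_integral_le_of_norm_le_const (f := fun t => g t - c)
    (a := a) (b := b) (C := D) (fun t ht => h t (by
      rw [Set.uIoc_of_le hle] at ht
      exact Set.Ioc_subset_Icc_self ht))
  rw [hab, abs_of_pos (by positivity), Real.norm_eq_abs] at hI
  rw [hsub, abs_mul, abs_of_pos hw]
  calc w * |∫ t in a..b, (g t - c)| ≤ w * (D * (1 / w)) := by gcongr
    _ = D := by field_simp

/-- A bounded function is controlled by a modulus-of-continuity bound plus a quadratic term. -/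
theorem abs_sub_le_add_sq {g : ℝ → ℝ} {B η δ : ℝ} (hB : ∀ t, |g t| ≤ B) (hη : 0 ≤ η)
    (hδ : 0 < δ) (hg : ∀ s t, |s - t| ≤ δ → |g s - g t| ≤ η) (s t : ℝ) :
    |g s - g t| ≤ η + 2 * B / δ ^ 2 * (s - t) ^ 2 := by
  have hB0 : 0 ≤ B := (abs_nonneg _).trans (hB 0)
  rcases le_or_gt |s - t| δ with h | h
  · exact (hg s t h).trans (le_add_of_nonneg_right (by positivity))
  · have h1 : δ ^ 2 ≤ (s - t) ^ 2 := by
      rw [← sq_abs (s - t)]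
      gcongr
    have h2 : |g s - g t| ≤ 2 * B := by
      linarith [abs_sub (g s) (g t), hB s, hB t]
    calc |g s - g t| ≤ 2 * B / δ ^ 2 * δ ^ 2 := by rwa [div_mul_cancel₀ _ (by positivity)]
      _ ≤ 2 * B / δ ^ 2 * (s - t) ^ 2 := by gcongr
      _ ≤ _ := le_add_of_nonneg_left hη

/-- For bounded log-uniformly continuous `f`, `‖I_w^χ f - f‖_∞ → 0` as `w → ∞`. -/
theorem uniform_convergence_of_kantExp
    (χ f : ℝ → ℝ)
    (hχc : ContinuousOn χ (Set.Ioi 0))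
    -- (i) partition of unity
    (hχ1 : ∀ x > (0 : ℝ), ∀ w > (0 : ℝ),
      HasSum (fun k : ℤ => χ (Real.exp (-(k : ℝ)) * x ^ w)) 1)
    -- (ii) M₂(χ) < ∞
    (hM2 : ∃ C : ℝ, ∀ u > (0 : ℝ),
      Summable (fun k : ℤ =>
        |χ (Real.exp (-(k : ℝ)) * u)| * |(k : ℝ) - Real.log u| ^ 2) ∧
      (∑' k : ℤ, |χ (Real.exp (-(k : ℝ)) * u)| * |(k : ℝ) - Real.log u| ^ 2) ≤ C)
    -- (ii) uniform vanishing of the tails of the second absolute moment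
    (htail : ∀ ε > (0 : ℝ), ∃ γ₀ : ℝ, ∀ γ ≥ γ₀, ∀ u > (0 : ℝ),
      (∑' k : {k : ℤ // γ < |(k : ℝ) - Real.log u|},
        |χ (Real.exp (-((k : ℤ) : ℝ)) * u)| * |((k : ℤ) : ℝ) - Real.log u| ^ 2) < ε)
    -- f bounded
    (hfb : ∃ B : ℝ, ∀ x > (0 : ℝ), |f x| ≤ B)
    -- f log-uniformly continuous on ℝ⁺
    (hfu : ∀ ε > (0 : ℝ), ∃ δ > (0 : ℝ), ∀ u > (0 : ℝ), ∀ v > (0 : ℝ),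
      |Real.log u - Real.log v| ≤ δ → |f u - f v| < ε) :
    ∀ ε > (0 : ℝ), ∃ w₀ : ℝ, ∀ w ≥ w₀, ∀ x > (0 : ℝ),
      |kantExp χ f w x - f x| ≤ ε := by
  intro ε hε
  obtain ⟨M, hM⟩ := exists_tsum_abs_kernel_le hχc hM2
  obtain ⟨C, hC⟩ := hM2
  obtain ⟨B, hB⟩ := hfb
  have hB0 : 0 ≤ B := (abs_nonneg _).trans (hB 1 one_pos)
  have hC0 : 0 ≤ C := (tsum_nonneg fun _ => by positivity).trans (hC 1 one_pos).2
  have hM0 : 0 ≤ M := (tsum_nonneg fun _ => abs_nonneg _).trans (hM 1 one_pos).2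
  obtain ⟨δ, hδ, hfδ⟩ := hfu (ε / (2 * (M + 1))) (by positivity)
  set η := ε / (2 * (M + 1)) with hη
  have hη0 : 0 < η := by positivity
  set g : ℝ → ℝ := fun t => f (Real.exp t) with hgdef
  have hgc : Continuous g := by
    rw [Metric.continuous_iff]
    intro b r hr
    obtain ⟨d, hd, hfd⟩ := hfu r hr
    refine ⟨d, hd, fun a ha => hfd _ (Real.exp_pos _) _ (Real.exp_pos _) ?_⟩
    rw [Real.log_exp, Real.log_exp]
    exact ha.le
  have hgq := abs_sub_le_add_sq (g := g) (fun t => hB _ (Real.exp_pos t)) hη0.le hδ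
    (fun s t hst => (hfδ _ (Real.exp_pos s) _ (Real.exp_pos t) (by
      rwa [Real.log_exp, Real.log_exp])).le)
  refine ⟨max 1 (8 * B / δ ^ 2 * (C + M) / ε), fun w hw x hx => ?_⟩
  have hw1 : 1 ≤ w := (le_max_left _ _).trans hw
  have hw0 : 0 < w := one_pos.trans_le hw1
  have hwε : 8 * B / δ ^ 2 * (C + M) ≤ w * ε := (div_le_iff₀ hε).1 ((le_max_right _ _).trans hw)
  have hu : 0 < x ^ w := Real.rpow_pos_of_pos hx w
  have hlog : Real.log (x ^ w) = w * Real.log x := Real.log_rpow hx w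
  obtain ⟨hs2, hle2⟩ := hC _ hu
  obtain ⟨hs0, hle0⟩ := hM _ hu
  set D := 4 * B / δ ^ 2 / w ^ 2 with hD
  have hD0 : 0 ≤ D := by positivity
  have hmean : ∀ k : ℤ,
      |w * (∫ t in ((k : ℝ) / w)..(((k : ℝ) + 1) / w), f (Real.exp t)) - f x| ≤
        η + D * (|(k : ℝ) - Real.log (x ^ w)| ^ 2 + 1) := by
    intro k
    refine abs_mul_integral_sub_le (g := g) hgc hw0 (by ring) fun t ht => ?_
    have hgx : f x = g (Real.log x) := by rw [hgdef]; simp only [Real.exp_log hx]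
    rw [hgx]
    refine (hgq t (Real.log x)).trans ?_
    have h1 : (k : ℝ) ≤ t * w := (div_le_iff₀ hw0).1 ht.1
    have h2 : t * w ≤ k + 1 := (le_div_iff₀ hw0).1 ht.2
    have h3 : (w * (t - Real.log x)) ^ 2 ≤ 2 * (|(k : ℝ) - Real.log (x ^ w)| ^ 2 + 1) := by
      rw [sq_abs, hlog]
      nlinarith [sq_nonneg ((k : ℝ) - w * Real.log x - (t * w - k)),
        mul_nonneg (sub_nonneg.2 h1) (sub_nonneg.2 h2)]
    have h4 : (t - Real.log x) ^ 2 ≤ 2 * (|(k : ℝ) - Real.log (x ^ w)| ^ 2 + 1) / w ^ 2 := by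
      rw [le_div_iff₀ (by positivity)]
      linarith [mul_pow w (t - Real.log x) 2]
    calc η + 2 * B / δ ^ 2 * (t - Real.log x) ^ 2
        ≤ η + 2 * B / δ ^ 2 * (2 * (|(k : ℝ) - Real.log (x ^ w)| ^ 2 + 1) / w ^ 2) := by gcongr
      _ = _ := by rw [hD]; ring
  have hmaj := (hs0.hasSum.mul_left (η + D)).add (hs2.hasSum.mul_left D)
  have hterm : ∀ k : ℤ, ‖χ (Real.exp (-(k : ℝ)) * x ^ w) *
      (w * (∫ t in ((k : ℝ) / w)..(((k : ℝ) + 1) / w), f (Real.exp t)) - f x)‖ ≤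
      (η + D) * |χ (Real.exp (-(k : ℝ)) * x ^ w)| +
        D * (|χ (Real.exp (-(k : ℝ)) * x ^ w)| * |(k : ℝ) - Real.log (x ^ w)| ^ 2) := by
    intro k
    rw [Real.norm_eq_abs, abs_mul]
    refine (mul_le_mul_of_nonneg_left (hmean k) (abs_nonneg _)).trans (le_of_eq ?_)
    ring
  have hkant : kantExp χ f w x - f x = ∑' k : ℤ, χ (Real.exp (-(k : ℝ)) * x ^ w) *
      (w * (∫ t in ((k : ℝ) / w)..(((k : ℝ) + 1) / w), f (Real.exp t)) - f x) := by
    have hd := (Summable.of_norm_bounded hmaj.summable hterm).hasSum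
    have h := hd.add ((hχ1 x hx w hw0).mul_right (f x))
    rw [one_mul] at h
    rw [kantExp, sub_eq_iff_eq_add, ← h.tsum_eq]
    exact tsum_congr fun k => by ring
  rw [hkant, ← Real.norm_eq_abs]
  refine (tsum_of_norm_bounded hmaj hterm).trans ?_
  have hηM : η * M ≤ ε / 2 := by
    rw [hη, div_mul_eq_mul_div, div_le_div_iff₀ (by positivity) (by norm_num)]
    nlinarith
  have hDM : D * (C + M) ≤ ε / 2 := by
    have hww : w * ε ≤ w ^ 2 * ε := by gcongr; nlinarith
    have : D * (C + M) = (8 * B / δ ^ 2 * (C + M)) / 2 / w ^ 2 := by rw [hD]; ring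
    rw [this, div_le_iff₀ (by positivity)]
    linarith
  calc _ ≤ (η + D) * M + D * C := by gcongr
    _ ≤ ε := by linarith
end

section
/- Let χ: ℝ⁺ → ℝ be a continuous kernel function satisfying: (i) ∑_{k=-∞}^{+∞} χ(e^{-k} x^w) = 1 for every x ∈ ℝ⁺ and w > 0; (ii) M₂(χ) < +∞ and lim_{γ→+∞} ∑_{|k - log u| > γ} |χ(e^{-k} u)| |k - log u|² = 0 uniformly with respect to u ∈ ℝ⁺; and assume additionally that the first order moment m₁(χ, u) := ∑_{k=-∞}^{+∞} χ(e^{-k} u)(k - log u) vanishes for all u ∈ ℝ⁺. Let f: ℝ⁺ → ℝ be bounded and twice continuously differentiable on ℝ⁺. Then for every x ∈ ℝ⁺, lim_{w→∞} w [(I_w^χ f)(x) - f(x)] = (θf)(x)/2, where (θf)(x) = x f'(x) is the Mellin differential operator. -/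
open Real MeasureTheory Filter Topology

/-- A bounded `C²` function on the line is globally approximated by its tangent up to a
quadratic error. -/
theorem exists_abs_sub_tangent_le_sq {g : ℝ → ℝ} (hg : ContDiff ℝ 2 g) {B : ℝ}
    (hB : ∀ u, |g u| ≤ B) (s : ℝ) :
    ∃ K : ℝ, 0 ≤ K ∧ ∀ u, |g u - g s - deriv g s * (u - s)| ≤ K * (u - s) ^ 2 := by
  have hd : Differentiable ℝ g := hg.differentiable (by norm_num)
  have hg' : ContDiff ℝ 1 (deriv g) := by
    have h : ContDiff ℝ (1 + 1) g := by simpa [one_add_one_eq_two] using hg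
    exact (contDiff_succ_iff_deriv.1 h).2.2
  have hd' : DifferentiableAt ℝ (deriv g) s := (hg'.differentiable (by norm_num)) s
  obtain ⟨L, hL0, hL⟩ := hd'.isBigO_sub.exists_pos
  obtain ⟨δ, hδ, hball⟩ := Metric.eventually_nhds_iff.1 hL.bound
  have hB0 : 0 ≤ B := (abs_nonneg _).trans (hB s)
  refine ⟨L + (2 * B / δ ^ 2 + |deriv g s| / δ), by positivity, fun u => ?_⟩
  rcases lt_or_ge |u - s| δ with hu | hu
  · have key := (convex_closedBall s |u - s|).norm_image_sub_le_of_norm_hasDerivWithin_le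
      (f := fun v => g v - deriv g s * v) (f' := fun v => deriv g v - deriv g s)
      (C := L * |u - s|) (x := s) (y := u)
      (fun v _ => by
        have h : HasDerivAt (fun v => g v - deriv g s * v) (deriv g v - deriv g s * 1) v :=
          (hd v).hasDerivAt.sub ((hasDerivAt_id v).const_mul (deriv g s))
        rw [mul_one] at h
        exact h.hasDerivWithinAt)
      (fun v hv => by
        have hv' : |v - s| ≤ |u - s| := by simpa [Real.dist_eq] using hv
        have h1 := hball (y := v) (by rw [Real.dist_eq]; linarith)
        rw [Real.norm_eq_abs (v - s)] at h1
        exact h1.trans (by gcongr))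
      (by simp) (by simp [Real.dist_eq])
    have h2 : |g u - g s - deriv g s * (u - s)| ≤ L * |u - s| * |u - s| := by
      rw [Real.norm_eq_abs, Real.norm_eq_abs] at key
      convert key using 2
      ring
    have h3 : L * |u - s| * |u - s| = L * (u - s) ^ 2 := by rw [mul_assoc, abs_mul_abs_self]; ring
    have h4 : 0 ≤ (2 * B / δ ^ 2 + |deriv g s| / δ) * (u - s) ^ 2 := by positivity
    linarith
  · have h1 : |g u - g s - deriv g s * (u - s)| ≤ 2 * B + |deriv g s| * |u - s| := by
      have := abs_sub (g u - g s) (deriv g s * (u - s))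
      have := abs_sub (g u) (g s)
      rw [← abs_mul]
      linarith [hB u, hB s]
    have hr : 1 ≤ |u - s| / δ := (one_le_div hδ).2 hu
    have h2 : 2 * B ≤ 2 * B * (|u - s| / δ) ^ 2 :=
      le_mul_of_one_le_right (by positivity) (one_le_pow₀ hr)
    have h3 : |deriv g s| * |u - s| ≤ |deriv g s| * |u - s| * (|u - s| / δ) :=
      le_mul_of_one_le_right (by positivity) hr
    have h4 : 2 * B * (|u - s| / δ) ^ 2 + |deriv g s| * |u - s| * (|u - s| / δ)
        = (2 * B / δ ^ 2 + |deriv g s| / δ) * (u - s) ^ 2 := by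
      rw [← sq_abs (u - s)]
      field_simp
    have h5 : 0 ≤ L * (u - s) ^ 2 := by positivity
    linarith

/-- A quadratic tangent bound controls the mean of `g` over `[k / w, (k + 1) / w]`. -/
theorem abs_average_sub_tangent_le {g : ℝ → ℝ} (hg : Continuous g) {K s m : ℝ} (hK : 0 ≤ K)
    (h : ∀ u, |g u - g s - m * (u - s)| ≤ K * (u - s) ^ 2) {w : ℝ} (hw : 0 < w) (k : ℝ) :
    |w * (∫ u in (k / w)..((k + 1) / w), g u) - (g s + m / w * (k - w * s + 1 / 2))|
      ≤ 2 * K / w ^ 2 * (|k - w * s| ^ 2 + 1) := by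
  have hlen : (k + 1) / w - k / w = 1 / w := by ring
  have hle : k / w ≤ (k + 1) / w := by gcongr; linarith
  have hint : ∫ u in (k / w)..((k + 1) / w), (g u - (g s + m * (u - s)))
      = (∫ u in (k / w)..((k + 1) / w), g u)
        - (g s + m / w * (k - w * s + 1 / 2)) / w := by
    rw [intervalIntegral.integral_sub (hg.intervalIntegrable _ _)
      (Continuous.intervalIntegrable (by fun_prop) _ _)]
    congr 1
    have hD : ∀ u ∈ Set.uIcc (k / w) ((k + 1) / w),
        HasDerivAt (fun u => g s * u + m * ((u - s) ^ 2 / 2)) (g s + m * (u - s)) u := by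
      intro u _
      have h1 := (hasDerivAt_id u).const_mul (g s)
      have h2 := ((((hasDerivAt_id u).sub_const s).pow 2).div_const 2).const_mul m
      refine (h1.add h2).congr_deriv ?_
      simp
    rw [intervalIntegral.integral_eq_sub_of_hasDerivAt hD
      (Continuous.intervalIntegrable (by fun_prop) _ _)]
    field_simp
    ring
  have hbound : ‖∫ u in (k / w)..((k + 1) / w), (g u - (g s + m * (u - s)))‖
      ≤ K * (2 / w ^ 2 * (|k - w * s| ^ 2 + 1)) * |(k + 1) / w - k / w| := by
    refine intervalIntegral.norm_integral_le_of_norm_le_const fun u hu => ?_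
    rw [Set.uIoc_of_le hle] at hu
    have h1 := h u
    rw [Real.norm_eq_abs, ← sub_sub]
    refine h1.trans (mul_le_mul_of_nonneg_left ?_ hK)
    have ha : k < u * w := (div_lt_iff₀ hw).1 hu.1
    have hb : u * w ≤ k + 1 := (le_div_iff₀ hw).1 hu.2
    rw [sq_abs, div_mul_eq_mul_div, le_div_iff₀ (by positivity)]
    have hsq : (u * w - k) ^ 2 ≤ 1 := by nlinarith
    nlinarith [sq_nonneg ((k - w * s) - (u * w - k))]
  rw [hint, hlen, Real.norm_eq_abs, abs_of_pos (by positivity : 0 < 1 / w)] at hbound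
  have hfac : w * (∫ u in (k / w)..((k + 1) / w), g u) - (g s + m / w * (k - w * s + 1 / 2))
      = w * ((∫ u in (k / w)..((k + 1) / w), g u)
        - (g s + m / w * (k - w * s + 1 / 2)) / w) := by
    field_simp
  rw [hfac, abs_mul, abs_of_pos hw]
  refine (mul_le_mul_of_nonneg_left hbound hw.le).trans (le_of_eq ?_)
  field_simp

/-- A continuous kernel with bounded second absolute moment has bounded zeroth absolute moment. -/
theorem exists_bound_tsum_abs_kernel {χ : ℝ → ℝ} (hχ : ContinuousOn χ (Set.Ioi 0)) {C : ℝ}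
    (hC : ∀ u > (0 : ℝ),
      Summable (fun k : ℤ =>
        |χ (Real.exp (-(k : ℝ)) * u)| * |(k : ℝ) - Real.log u| ^ 2) ∧
      (∑' k : ℤ, |χ (Real.exp (-(k : ℝ)) * u)| * |(k : ℝ) - Real.log u| ^ 2) ≤ C) :
    ∃ D : ℝ, ∀ u > (0 : ℝ), Summable (fun k : ℤ => |χ (Real.exp (-(k : ℝ)) * u)|) ∧
      (∑' k : ℤ, |χ (Real.exp (-(k : ℝ)) * u)|) ≤ D := by
  obtain ⟨D, hD⟩ :=
    (isCompact_Icc (a := Real.exp (-1)) (b := Real.exp 1)).exists_bound_of_continuousOn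
    (hχ.mono fun y hy => (Real.exp_pos _).trans_le hy.1)
  have hD0 : 0 ≤ D := (norm_nonneg _).trans (hD 1 ⟨by simp, by simp⟩)
  refine ⟨C + (D + D), fun u hu => ?_⟩
  obtain ⟨hs, hsC⟩ := hC u hu
  set n : ℤ := ⌊Real.log u⌋ with hn
  have hpt : ∀ k : ℤ, |χ (Real.exp (-(k : ℝ)) * u)| ≤
      |χ (Real.exp (-(k : ℝ)) * u)| * |(k : ℝ) - Real.log u| ^ 2
        + ((if k = n then D else 0) + (if k = n + 1 then D else 0)) := by
    intro k
    have hi : ∀ j : ℤ, 0 ≤ (if k = j then D else 0) := fun j => by split_ifs <;> simp [hD0]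
    rcases lt_or_ge |(k : ℝ) - Real.log u| 1 with h | h
    · have hk := abs_lt.1 h
      have hval : |χ (Real.exp (-(k : ℝ)) * u)| ≤ D := by
        refine hD _ ?_
        rw [← Real.exp_log hu, ← Real.exp_add]
        exact ⟨Real.exp_le_exp.2 (by linarith), Real.exp_le_exp.2 (by linarith)⟩
      have hmem : k = n ∨ k = n + 1 := by
        have h1 : n < k + 1 := by
          rw [hn, Int.floor_lt]; push_cast; linarith
        have h2 : k - 1 ≤ n := by
          rw [hn, Int.le_floor]; push_cast; linarith
        omega
      have hp : 0 ≤ |χ (Real.exp (-(k : ℝ)) * u)| * |(k : ℝ) - Real.log u| ^ 2 := by positivity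
      have hge : D ≤ (if k = n then D else 0) + (if k = n + 1 then D else 0) := by
        rcases hmem with h | h
        · rw [if_pos h]; linarith [hi (n + 1)]
        · rw [if_pos h]; linarith [hi n]
      linarith
    · have := le_mul_of_one_le_right (abs_nonneg (χ (Real.exp (-(k : ℝ)) * u)))
        (one_le_pow₀ h (n := 2))
      linarith [hi n, hi (n + 1)]
  have hsum := hs.hasSum.add ((hasSum_ite_eq n D).add (hasSum_ite_eq (n + 1) D))
  have hsm : Summable (fun k : ℤ => |χ (Real.exp (-(k : ℝ)) * u)|) :=
    .of_nonneg_of_le (fun _ => abs_nonneg _) hpt hsum.summable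
  exact ⟨hsm, (hasSum_le hpt hsm.hasSum hsum).trans (by linarith)⟩

/-- Voronovskaya type formula: `lim_{w→∞} w[(I_w^χ f)(x) - f(x)] = (θf)(x)/2`,
where `(θf)(x) = x f'(x)` is the Mellin derivative. -/
theorem voronovskaya_kantExp
    (χ f : ℝ → ℝ)
    (hχc : ContinuousOn χ (Set.Ioi 0))
    -- (i) partition of unity
    (hχ1 : ∀ x > (0 : ℝ), ∀ w > (0 : ℝ),
      HasSum (fun k : ℤ => χ (Real.exp (-(k : ℝ)) * x ^ w)) 1)
    -- (ii) M₂(χ) < ∞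
    (hM2 : ∃ C : ℝ, ∀ u > (0 : ℝ),
      Summable (fun k : ℤ =>
        |χ (Real.exp (-(k : ℝ)) * u)| * |(k : ℝ) - Real.log u| ^ 2) ∧
      (∑' k : ℤ, |χ (Real.exp (-(k : ℝ)) * u)| * |(k : ℝ) - Real.log u| ^ 2) ≤ C)
    -- (ii) uniform vanishing of the tails of the second absolute moment
    (htail : ∀ ε > (0 : ℝ), ∃ γ₀ : ℝ, ∀ γ ≥ γ₀, ∀ u > (0 : ℝ),
      (∑' k : {k : ℤ // γ < |(k : ℝ) - Real.log u|},
        |χ (Real.exp (-((k : ℤ) : ℝ)) * u)| * |((k : ℤ) : ℝ) - Real.log u| ^ 2) < ε)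
    -- first order algebraic moment m₁(χ, u) vanishes for all u ∈ ℝ⁺
    (hm1 : ∀ u > (0 : ℝ),
      HasSum (fun k : ℤ => χ (Real.exp (-(k : ℝ)) * u) * ((k : ℝ) - Real.log u)) 0)
    -- f bounded and twice continuously differentiable on ℝ⁺
    (hfb : ∃ B : ℝ, ∀ x > (0 : ℝ), |f x| ≤ B)
    (hf : ContDiffOn ℝ 2 f (Set.Ioi 0))
    (x : ℝ) (hx : 0 < x) :
    Tendsto (fun w : ℝ => w * (kantExp χ f w x - f x)) atTop
      (nhds (x * deriv f x / 2)) := by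
  obtain ⟨B, hB⟩ := hfb
  obtain ⟨C, hC⟩ := hM2
  obtain ⟨D, hD⟩ := exists_bound_tsum_abs_kernel hχc hC
  set s := Real.log x with hs
  set g : ℝ → ℝ := fun u => f (Real.exp u) with hgdef
  have hg : ContDiff ℝ 2 g :=
    contDiffOn_univ.1 (hf.comp Real.contDiff_exp.contDiffOn fun u _ => Real.exp_pos u)
  have hgs : g s = f x := by rw [hgdef, hs]; simp only [Real.exp_log hx]
  have hg' : deriv g s = x * deriv f x := by
    have hfx : DifferentiableAt ℝ f (Real.exp s) :=
      (hf.differentiableOn (by norm_num)).differentiableAt (Ioi_mem_nhds (Real.exp_pos s))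
    have h := (hfx.hasDerivAt.comp s (Real.hasDerivAt_exp s)).deriv
    rw [hs, Real.exp_log hx, mul_comm] at h
    exact h
  obtain ⟨K, hK, hKg⟩ := exists_abs_sub_tangent_le_sq hg (fun u => hB _ (Real.exp_pos u)) s
  have hest : ∀ w > (0 : ℝ),
      |w * (kantExp χ f w x - f x) - x * deriv f x / 2| ≤ 2 * K * (C + D) / w := by
    intro w hw
    have hu : 0 < x ^ w := Real.rpow_pos_of_pos hx w
    have hlog : Real.log (x ^ w) = w * s := Real.log_rpow hx w
    have h0 := hχ1 x hx w hw
    have h1 := hm1 _ hu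
    obtain ⟨h2, h2C⟩ := hC _ hu
    obtain ⟨h3, h3D⟩ := hD _ hu
    rw [hlog] at h1 h2 h2C
    set a : ℤ → ℝ := fun k => χ (Real.exp (-(k : ℝ)) * x ^ w) with ha
    set A : ℤ → ℝ := fun k => w * ∫ u in ((k : ℝ) / w)..(((k : ℝ) + 1) / w), g u with hA
    set T : ℤ → ℝ := fun k => g s + deriv g s / w * (k - w * s + 1 / 2) with hT
    have hlin : HasSum (fun k => a k * T k) (g s + deriv g s / w / 2) := by
      have h := (h0.mul_right (g s + deriv g s / w / 2)).add (h1.mul_right (deriv g s / w))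
      rw [one_mul, zero_mul, add_zero] at h
      refine (funext fun k => ?_ : (fun k => a k * T k) = _) ▸ h
      simp only [hT, ha]
      ring
    have hmaj := (h2.hasSum.add h3.hasSum).mul_left (2 * K / w ^ 2)
    have hle : ∀ k, ‖a k * (A k - T k)‖ ≤
        2 * K / w ^ 2 * (|a k| * |(k : ℝ) - w * s| ^ 2 + |a k|) := by
      intro k
      rw [norm_mul, Real.norm_eq_abs, Real.norm_eq_abs]
      have h := abs_average_sub_tangent_le hg.continuous hK hKg hw k
      refine (mul_le_mul_of_nonneg_left h (abs_nonneg (a k))).trans (le_of_eq ?_)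
      ring
    have hdiff : Summable (fun k => a k * (A k - T k)) :=
      .of_norm_bounded hmaj.summable hle
    have hnorm := tsum_of_norm_bounded hmaj hle
    have hkant : kantExp χ f w x = (g s + deriv g s / w / 2) + ∑' k, a k * (A k - T k) := by
      rw [← (hlin.add hdiff.hasSum).tsum_eq]
      exact tsum_congr fun k => by simp only [ha, hA, hgdef]; ring
    rw [hkant, ← hgs, ← hg']
    have hw' : w * (g s + deriv g s / w / 2 + ∑' k, a k * (A k - T k) - g s) - deriv g s / 2
        = w * ∑' k, a k * (A k - T k) := by
      field_simp
      ring
    rw [hw', abs_mul, abs_of_pos hw]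
    calc w * |∑' k, a k * (A k - T k)|
        ≤ w * (2 * K / w ^ 2 * (C + D)) := by
          refine mul_le_mul_of_nonneg_left (hnorm.trans ?_) hw.le
          gcongr
      _ = 2 * K * (C + D) / w := by field_simp
  rw [tendsto_iff_norm_sub_tendsto_zero]
  refine squeeze_zero' (Eventually.of_forall fun _ => norm_nonneg _) ?_
    (tendsto_const_nhds.div_atTop tendsto_id : Tendsto (fun w : ℝ => 2 * K * (C + D) / w) atTop _)
  filter_upwards [eventually_gt_atTop 0] with w hw using hest w hw
end

section
/- Let χ: ℝ⁺ → ℝ be a continuous kernel function satisfying: (i) ∑_{k=-∞}^{+∞} χ(e^{-k} x^w) = 1 for every x ∈ ℝ⁺ and w > 0; (ii) M₂(χ) < +∞ and lim_{γ→+∞} ∑_{|k - log u| > γ} |χ(e^{-k} u)| |k - log u|² = 0 uniformly with respect to u ∈ ℝ⁺; and assume the first order moment m₁(χ, u) = 0 for all u ∈ ℝ⁺. Let f: ℝ⁺ → ℝ be twice continuously differentiable and suppose there exist positive constants α, β such that |f(x)| ≤ α + β |log x| for all x ∈ ℝ⁺. Then for every x ∈ ℝ⁺, the series (I_w^χ f)(x)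 converges absolutely for every w > 0, and lim_{w→∞} w [(I_w^χ f)(x) - f(x)] = (θf)(x)/2, where (θf)(x) = x f'(x). -/
open Real MeasureTheory Filter Topology

/-- A continuous function on `(0, ∞)` with finite second absolute moment also has a finite
absolute moment with weight `(|k - log u| + 1) ^ 2`, uniformly in `u`. -/
lemma exists_bound_tsum_abs_mul_add_one_sq {χ : ℝ → ℝ} (hχc : ContinuousOn χ (Set.Ioi 0))
    (hM2 : ∃ C : ℝ, ∀ u > (0 : ℝ),
      Summable (fun k : ℤ =>
        |χ (Real.exp (-(k : ℝ)) * u)| * |(k : ℝ) - Real.log u| ^ 2) ∧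
      (∑' k : ℤ, |χ (Real.exp (-(k : ℝ)) * u)| * |(k : ℝ) - Real.log u| ^ 2) ≤ C) :
    ∃ D : ℝ, ∀ u > (0 : ℝ),
      Summable (fun k : ℤ =>
        |χ (Real.exp (-(k : ℝ)) * u)| * (|(k : ℝ) - Real.log u| + 1) ^ 2) ∧
      (∑' k : ℤ, |χ (Real.exp (-(k : ℝ)) * u)| * (|(k : ℝ) - Real.log u| + 1) ^ 2) ≤ D := by
  obtain ⟨C, hC⟩ := hM2
  obtain ⟨B, hB⟩ : ∃ B, ∀ v ∈ Set.Icc (exp (-1)) (exp 1), ‖χ v‖ ≤ B :=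
    isCompact_Icc.exists_bound_of_continuousOn
      (hχc.mono fun v hv => (exp_pos _).trans_le hv.1)
  have hB0 : 0 ≤ B := (norm_nonneg _).trans
    (hB 1 ⟨by simp, by simp⟩)
  refine ⟨4 * (C + B + B), fun u hu => ?_⟩
  obtain ⟨hs, hle⟩ := hC u hu
  have hsum := ((hs.hasSum.add (hasSum_ite_eq ⌊log u⌋ B)).add
    (hasSum_ite_eq (⌊log u⌋ + 1) B)).mul_left 4
  have key : ∀ k : ℤ, |χ (exp (-(k : ℝ)) * u)| * (|(k : ℝ) - log u| + 1) ^ 2 ≤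
      4 * (|χ (exp (-(k : ℝ)) * u)| * |(k : ℝ) - log u| ^ 2 + (if k = ⌊log u⌋ then B else 0)
        + (if k = ⌊log u⌋ + 1 then B else 0)) := by
    intro k
    have h1 : (0 : ℝ) ≤ if k = ⌊log u⌋ then B else 0 := by split_ifs <;> simp [hB0]
    have h2 : (0 : ℝ) ≤ if k = ⌊log u⌋ + 1 then B else 0 := by split_ifs <;> simp [hB0]
    have hχ0 := abs_nonneg (χ (exp (-(k : ℝ)) * u))
    have hk0 := abs_nonneg ((k : ℝ) - log u)
    rcases le_or_gt 1 |(k : ℝ) - log u| with hk | hk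
    · have h3 : (|(k : ℝ) - log u| + 1) ^ 2 ≤ 4 * |(k : ℝ) - log u| ^ 2 := by nlinarith
      have := mul_le_mul_of_nonneg_left h3 hχ0
      linarith
    · have h3 : (|(k : ℝ) - log u| + 1) ^ 2 ≤ 4 := by nlinarith
      obtain ⟨ha, hb⟩ := abs_lt.1 hk
      have hexp : exp (-(k : ℝ)) * u = exp (log u - k) := by
        rw [sub_eq_add_neg, exp_add, exp_log hu, mul_comm]
      have hχB : |χ (exp (-(k : ℝ)) * u)| ≤ B := by
        rw [hexp]
        exact hB _ ⟨exp_le_exp.2 (by linarith), exp_le_exp.2 (by linarith)⟩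
      have hcases : k = ⌊log u⌋ ∨ k = ⌊log u⌋ + 1 := by
        have e1 : ⌊log u⌋ < k + 1 := Int.floor_lt.2 (by push_cast; linarith)
        have e2 : k - 1 ≤ ⌊log u⌋ := Int.le_floor.2 (by push_cast; linarith)
        omega
      have h4 : B ≤ (if k = ⌊log u⌋ then B else 0) + (if k = ⌊log u⌋ + 1 then B else 0) := by
        rcases hcases with h | h <;> simp [h]
      have h5 : 0 ≤ |χ (exp (-(k : ℝ)) * u)| * |(k : ℝ) - log u| ^ 2 := by positivity
      have := mul_le_mul_of_nonneg_left h3 hχ0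
      linarith
  have hsm := Summable.of_nonneg_of_le (fun k => by positivity) key hsum.summable
  refine ⟨hsm, ?_⟩
  have := hasSum_le key hsm.hasSum hsum
  linarith

/-- A `C²` function of at most linear growth satisfies a global quadratic first order Taylor
estimate. -/
lemma exists_abs_sub_taylor_le_sq {g : ℝ → ℝ} (hg : ContDiff ℝ 2 g) {α β : ℝ}
    (hβ : 0 ≤ β) (hgrowth : ∀ t, |g t| ≤ α + β * |t|) (a : ℝ) :
    ∃ A : ℝ, ∀ t, |g t - g a - deriv g a * (t - a)| ≤ A * (t - a) ^ 2 := by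
  have hg1 : ContDiff ℝ 1 (deriv g) := (contDiff_succ_iff_deriv (n := 1).1 hg).2.2
  have hgd : Differentiable ℝ g := hg.differentiable (by norm_num)
  obtain ⟨K, s, hs, hK⟩ := hg1.contDiffAt.exists_lipschitzOnWith (x := a)
  obtain ⟨δ, hδ, hball⟩ := Metric.mem_nhds_iff.1 hs
  have hα : 0 ≤ α := by simpa using (abs_nonneg _).trans (hgrowth 0)
  set P := α + β * |a| + |g a|
  set Q := β + |deriv g a|
  have hP : 0 ≤ P := by positivity
  have hQ : 0 ≤ Q := by positivity
  refine ⟨K + P / δ ^ 2 + Q / δ, fun t => ?_⟩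
  have hPδ : 0 ≤ P / δ ^ 2 := by positivity
  have hQδ : 0 ≤ Q / δ := by positivity
  rcases lt_or_ge |t - a| δ with ht | ht
  · have hmv := (convex_uIcc a t).norm_image_sub_le_of_norm_hasDerivWithin_le
      (f := fun v => g v - deriv g a * v) (f' := fun v => deriv g v - deriv g a)
      (C := K * |t - a|) (fun v _ => by
        have := ((hasDerivAt_id v).const_mul (deriv g a))
        rw [mul_one] at this
        exact ((hgd v).hasDerivAt.sub this).hasDerivWithinAt)
      (fun v hv => by
        have hva : |v - a| ≤ |t - a| := Set.abs_sub_left_of_mem_uIcc hv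
        have hvs : v ∈ s := hball (by
          rw [Metric.mem_ball, Real.dist_eq]; exact hva.trans_lt ht)
        have := hK.dist_le_mul v hvs a (mem_of_mem_nhds hs)
        rw [Real.dist_eq, Real.dist_eq] at this
        exact this.trans (mul_le_mul_of_nonneg_left hva K.2))
      Set.left_mem_uIcc Set.right_mem_uIcc
    have e : g t - g a - deriv g a * (t - a) =
        (g t - deriv g a * t) - (g a - deriv g a * a) := by ring
    rw [e]
    refine hmv.trans ?_
    rw [Real.norm_eq_abs, mul_assoc, ← pow_two, sq_abs]
    nlinarith [sq_nonneg (t - a), mul_nonneg hPδ (sq_nonneg (t - a)),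
      mul_nonneg hQδ (sq_nonneg (t - a))]
  · have h1 : |g t - g a - deriv g a * (t - a)| ≤ P + Q * |t - a| := by
      have e1 : |g t - g a - deriv g a * (t - a)| ≤ |g t| + |g a| + |deriv g a| * |t - a| := by
        rw [← abs_mul]
        exact (abs_sub _ _).trans (add_le_add_left (abs_sub _ _) _)
      have e2 : |t| ≤ |a| + |t - a| := by
        have := abs_add_le a (t - a)
        rwa [add_sub_cancel] at this
      have e3 := mul_le_mul_of_nonneg_left e2 hβ
      have e4 := hgrowth t
      simp only [P, Q]
      linarith
    have h2 : P ≤ P / δ ^ 2 * (t - a) ^ 2 := by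
      rw [div_mul_eq_mul_div, le_div_iff₀ (by positivity), ← sq_abs (t - a)]
      gcongr
    have h3 : Q * |t - a| ≤ Q / δ * (t - a) ^ 2 := by
      rw [div_mul_eq_mul_div, le_div_iff₀ hδ, ← sq_abs (t - a), pow_two, mul_assoc]
      gcongr
    have h4 : 0 ≤ K * (t - a) ^ 2 := by positivity
    linarith

/-- A global quadratic first order Taylor estimate carries over to Steklov means. -/
lemma abs_mean_sub_taylor_le {g : ℝ → ℝ} (hg : Continuous g) {a d A : ℝ}
    (hA : ∀ t, |g t - g a - d * (t - a)| ≤ A * (t - a) ^ 2) {w : ℝ} (hw : 0 < w) (k : ℝ) :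
    |w * (∫ t in (k / w)..((k + 1) / w), g t) - g a - d * ((k - w * a + 1 / 2) / w)| ≤
      A / w ^ 2 * (|k - w * a| + 1) ^ 2 := by
  have hA0 : 0 ≤ A := by simpa using (abs_nonneg _).trans (hA (a + 1))
  have hint : ∫ t in (k / w)..((k + 1) / w), (g t - g a - d * (t - a)) =
      (∫ t in (k / w)..((k + 1) / w), g t) - g a / w - d * ((k - w * a + 1 / 2) / w ^ 2) := by
    have i1 : IntervalIntegrable g volume (k / w) ((k + 1) / w) := hg.intervalIntegrable _ _
    have i2 : IntervalIntegrable (fun t => d * (t - a)) volume (k / w) ((k + 1) / w) :=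
      Continuous.intervalIntegrable (by fun_prop) _ _
    rw [intervalIntegral.integral_sub (i1.sub (by simp)) i2,
      intervalIntegral.integral_sub i1 (by simp), intervalIntegral.integral_const_mul,
      intervalIntegral.integral_sub (by simp) (by simp), integral_id]
    simp only [intervalIntegral.integral_const, smul_eq_mul]
    field_simp
    ring
  have hbd := intervalIntegral.norm_integral_le_of_norm_le_const
    (f := fun t => g t - g a - d * (t - a)) (a := k / w) (b := (k + 1) / w)
    (C := A / w ^ 2 * (|k - w * a| + 1) ^ 2) (fun t ht => by
      rw [Set.uIoc_of_le (by gcongr; linarith)] at ht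
      have h1 : k < t * w := (div_lt_iff₀ hw).1 ht.1
      have h2 : t * w ≤ k + 1 := (le_div_iff₀ hw).1 ht.2
      have h3 : |w * (t - a)| ≤ |k - w * a| + 1 := by
        rw [abs_le]
        constructor
        · linarith [neg_abs_le (k - w * a)]
        · linarith [le_abs_self (k - w * a)]
      refine (hA t).trans ?_
      have h4 : (w * (t - a)) ^ 2 ≤ (|k - w * a| + 1) ^ 2 := by
        rw [← sq_abs (w * (t - a))]
        gcongr
      calc A * (t - a) ^ 2 = A / w ^ 2 * (w * (t - a)) ^ 2 := by field_simp
        _ ≤ _ := by gcongr)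
  have e : w * (∫ t in (k / w)..((k + 1) / w), g t) - g a - d * ((k - w * a + 1 / 2) / w) =
      w * ∫ t in (k / w)..((k + 1) / w), (g t - g a - d * (t - a)) := by
    rw [hint]
    field_simp
  have hlen : |(k + 1) / w - k / w| = 1 / w := by
    rw [← sub_div, add_sub_cancel_left, abs_of_pos (by positivity)]
  rw [hlen, Real.norm_eq_abs] at hbd
  rw [e, abs_mul, abs_of_pos hw]
  calc w * |∫ t in (k / w)..((k + 1) / w), (g t - g a - d * (t - a))|
      ≤ w * (A / w ^ 2 * (|k - w * a| + 1) ^ 2 * (1 / w)) := by gcongr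
    _ = _ := by field_simp

/-- Voronovskaya formula under the logarithmic growth condition
`|f(x)| ≤ α + β|log x|` instead of boundedness; moreover the series is
absolutely convergent for every `w > 0`. -/
theorem voronovskaya_kantExp_log_growth
    (χ f : ℝ → ℝ)
    (hχc : ContinuousOn χ (Set.Ioi 0))
    -- (i) partition of unity
    (hχ1 : ∀ x > (0 : ℝ), ∀ w > (0 : ℝ),
      HasSum (fun k : ℤ => χ (Real.exp (-(k : ℝ)) * x ^ w)) 1)
    -- (ii) M₂(χ) < ∞
    (hM2 : ∃ C : ℝ, ∀ u > (0 : ℝ),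
      Summable (fun k : ℤ =>
        |χ (Real.exp (-(k : ℝ)) * u)| * |(k : ℝ) - Real.log u| ^ 2) ∧
      (∑' k : ℤ, |χ (Real.exp (-(k : ℝ)) * u)| * |(k : ℝ) - Real.log u| ^ 2) ≤ C)
    -- (ii) uniform vanishing of the tails of the second absolute moment
    (htail : ∀ ε > (0 : ℝ), ∃ γ₀ : ℝ, ∀ γ ≥ γ₀, ∀ u > (0 : ℝ),
      (∑' k : {k : ℤ // γ < |(k : ℝ) - Real.log u|},
        |χ (Real.exp (-((k : ℤ) : ℝ)) * u)| * |((k : ℤ) : ℝ) - Real.log u| ^ 2) < ε)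
    -- first order algebraic moment m₁(χ, u) vanishes for all u ∈ ℝ⁺
    (hm1 : ∀ u > (0 : ℝ),
      HasSum (fun k : ℤ => χ (Real.exp (-(k : ℝ)) * u) * ((k : ℝ) - Real.log u)) 0)
    -- f twice continuously differentiable on ℝ⁺
    (hf : ContDiffOn ℝ 2 f (Set.Ioi 0))
    -- growth condition: |f(x)| ≤ α + β |log x| on ℝ⁺
    (α β : ℝ) (hα : 0 < α) (hβ : 0 < β)
    (hgrowth : ∀ x > (0 : ℝ), |f x| ≤ α + β * |Real.log x|)
    (x : ℝ) (hx : 0 < x) :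
    (∀ w > (0 : ℝ),
      Summable (fun k : ℤ => |χ (Real.exp (-(k : ℝ)) * x ^ w) *
        (w * ∫ u in ((k : ℝ) / w)..(((k : ℝ) + 1) / w), f (Real.exp u))|)) ∧
    Tendsto (fun w : ℝ => w * (kantExp χ f w x - f x)) atTop
      (nhds (x * deriv f x / 2)) := by
  set g : ℝ → ℝ := fun t => f (exp t) with hgdef
  set L := log x with hL
  have hgC : ContDiff ℝ 2 g := by
    rw [← contDiffOn_univ]
    exact hf.comp contDiff_exp.contDiffOn fun t _ => exp_pos t
  have hgL : g L = f x := by simp only [hgdef, hL, exp_log hx]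
  have hdg : deriv g L = x * deriv f x := by
    have hfd : DifferentiableAt ℝ f (exp L) := by
      rw [hL, exp_log hx]
      exact (hf.differentiableOn (by norm_num)).differentiableAt (Ioi_mem_nhds hx)
    have := (hfd.hasDerivAt.comp L (hasDerivAt_exp L)).deriv
    rw [hL, exp_log hx, mul_comm] at this
    exact this
  obtain ⟨D, hD⟩ := exists_bound_tsum_abs_mul_add_one_sq hχc hM2
  obtain ⟨A, hA⟩ := exists_abs_sub_taylor_le_sq hgC hβ.le
    (fun t => by simpa using hgrowth (exp t) (exp_pos t)) L
  have hA0 : 0 ≤ A := by simpa using (abs_nonneg _).trans (hA (L + 1))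
  have hmean : ∀ w > (0 : ℝ), ∀ k : ℤ, _ := fun w hw k =>
    abs_mean_sub_taylor_le hgC.continuous hA hw (k : ℝ)
  have hlog : ∀ w : ℝ, log (x ^ w) = w * L := fun w => log_rpow hx w
  set d := deriv g L
  set J : ℝ → ℤ → ℝ := fun w k => w * ∫ t in ((k : ℝ) / w)..(((k : ℝ) + 1) / w), g t
  set a : ℝ → ℤ → ℝ := fun w k => χ (exp (-(k : ℝ)) * x ^ w)
  set R : ℝ → ℤ → ℝ := fun w k => J w k - g L - d * (((k : ℝ) - w * L + 1 / 2) / w) with hR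
  have hD' : ∀ w : ℝ, Summable (fun k : ℤ => |a w k| * (|(k : ℝ) - w * L| + 1) ^ 2) ∧
      ∑' k : ℤ, |a w k| * (|(k : ℝ) - w * L| + 1) ^ 2 ≤ D := fun w => by
    simpa only [hlog] using hD (x ^ w) (rpow_pos_of_pos hx w)
  have haR : ∀ w > (0 : ℝ), ∀ k, ‖a w k * R w k‖ ≤
      A / w ^ 2 * (|a w k| * (|(k : ℝ) - w * L| + 1) ^ 2) := fun w hw k => by
    rw [norm_mul, Real.norm_eq_abs, Real.norm_eq_abs, mul_left_comm]
    exact mul_le_mul_of_nonneg_left (hmean w hw k) (abs_nonneg _)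
  have hsR : ∀ w > (0 : ℝ), Summable (fun k => a w k * R w k) := fun w hw =>
    Summable.of_norm_bounded ((hD' w).1.mul_left _) (haR w hw)
  have hHas : ∀ w > (0 : ℝ), HasSum (fun k => a w k * J w k)
      (g L + d / (2 * w) + ∑' k, a w k * R w k) := fun w hw => by
    have h0 := hχ1 x hx w hw
    have h1 := hm1 (x ^ w) (rpow_pos_of_pos hx w)
    simp only [hlog] at h1
    have h2 := ((h0.mul_left (g L + d / (2 * w))).add (h1.mul_left (d / w))).add
      (hsR w hw).hasSum
    rw [mul_one, mul_zero, add_zero] at h2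
    have h3 : (fun k => a w k * J w k) = fun k : ℤ => (g L + d / (2 * w)) * a w k +
        d / w * (a w k * ((k : ℝ) - w * L)) + a w k * R w k := by
      ext k
      simp only [hR]
      field_simp
      ring
    rw [h3]
    exact h2
  refine ⟨fun w hw => (hHas w hw).summable.abs, ?_⟩
  have hR0 : Tendsto (fun w : ℝ => w * ∑' k, a w k * R w k) atTop (𝓝 0) := by
    refine squeeze_zero_norm' (a := fun w : ℝ => A * D / w) ?_
      (tendsto_const_nhds.div_atTop tendsto_id)
    filter_upwards [eventually_gt_atTop 0] with w hw
    have h1 := tsum_of_norm_bounded ((hD' w).1.hasSum.mul_left (A / w ^ 2)) (haR w hw)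
    rw [norm_mul, Real.norm_eq_abs, abs_of_pos hw]
    calc w * ‖∑' k, a w k * R w k‖ ≤ w * (A / w ^ 2 * D) := by
          gcongr
          exact h1.trans (mul_le_mul_of_nonneg_left (hD' w).2 (by positivity))
      _ = A * D / w := by field_simp
  have hlim := (tendsto_const_nhds (x := x * deriv f x / 2)).add hR0
  rw [add_zero] at hlim
  refine hlim.congr' ?_
  filter_upwards [eventually_gt_atTop 0] with w hw
  have hk : kantExp χ f w x = g L + d / (2 * w) + ∑' k, a w k * R w k := (hHas w hw).tsum_eq
  rw [hk, hgL, hdg]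
  field_simp
  ring
end

section
/- Let χ: ℝ⁺ → ℝ be a continuous kernel function with M₀(χ) < +∞ and M₁(χ) < +∞. Let f: ℝ⁺ → ℝ be a function for which there exist positive constants α, β with |f(x)| ≤ α + β |log x| for all x ∈ ℝ⁺. Then for every x ∈ ℝ⁺ and w > 0, ∑_{k=-∞}^{+∞} |χ(e^{-k} x^w)| · w ∫_{k/w}^{(k+1)/w} |f(e^u)| du ≤ (α + β |log x| + β/(2w)) M₀(χ) + (β/w) M₁(χ) < +∞; in particular, the series (I_w^χ f)(x) is absolutely convergent for every x ∈ ℝ⁺. -/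
open Real MeasureTheory Filter Topology

/-- The mean of `|f ∘ exp|` over `[k/w, (k+1)/w]` under a logarithmic growth bound on `f`, for an
arbitrary reference point `y`. -/
theorem mean_abs_comp_exp_le_of_log_growth {f : ℝ → ℝ} (hfm : Measurable f) {α β : ℝ}
    (hβ : 0 ≤ β) (hgrowth : ∀ x > (0 : ℝ), |f x| ≤ α + β * |Real.log x|)
    {w : ℝ} (hw : 0 < w) (k y : ℝ) :
    w * ∫ u in (k / w)..((k + 1) / w), |f (Real.exp u)| ≤
      α + β * |y| + β / (2 * w) + β / w * |k - w * y| := by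
  have hab : k / w ≤ (k + 1) / w := by gcongr; linarith
  have hbound : ∀ u, |f (Real.exp u)| ≤ α + β * |u| := fun u => by
    simpa using hgrowth (Real.exp u) (Real.exp_pos u)
  have hint : IntervalIntegrable (fun u => |f (Real.exp u)|) volume (k / w) ((k + 1) / w) := by
    refine IntervalIntegrable.mono_fun' (g := fun u => α + β * |u|)
      (Continuous.intervalIntegrable (by fun_prop) _ _) ?_ ?_
    · exact (hfm.comp Real.measurable_exp).abs.aestronglyMeasurable
    · exact Eventually.of_forall fun u => by simpa using hbound u
  have hle : ∀ u ∈ Set.Icc (k / w) ((k + 1) / w),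
      |f (Real.exp u)| ≤ (α + β * (|y| + |k / w - y|) - β * (k / w)) + β * u := by
    intro u hu
    have htri : |u| ≤ |y| + |k / w - y| + (u - k / w) := by
      have h1 := abs_add_three y (k / w - y) (u - k / w)
      rw [abs_of_nonneg (sub_nonneg.2 hu.1)] at h1
      simpa using h1
    nlinarith [hbound u, mul_le_mul_of_nonneg_left htri hβ]
  have hmono := intervalIntegral.integral_mono_on hab hint
    (Continuous.intervalIntegrable (by fun_prop) _ _) hle
  rw [intervalIntegral.integral_add (by simp)
    (Continuous.intervalIntegrable (by fun_prop) _ _), intervalIntegral.integral_const,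
    intervalIntegral.integral_const_mul, integral_id, smul_eq_mul] at hmono
  have hscale : |k / w - y| = |k - w * y| / w := by
    rw [← abs_of_pos hw, ← abs_div, abs_of_pos hw]
    congr 1
    field_simp
  rw [hscale] at hmono
  refine (mul_le_mul_of_nonneg_left hmono hw.le).trans_eq ?_
  field_simp
  ring

/-- For kernels with finite `M₀(χ)`, `M₁(χ)` and functions of logarithmic growth
`|f(x)| ≤ α + β|log x|`, the Kantorovich exponential sampling series is absolutely
convergent, with the explicit bound
`∑_k |χ(e^{-k}x^w)| · w∫|f(e^u)| ≤ (α + β|log x| + β/(2w)) M₀(χ) + (β/w) M₁(χ)`. -/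
theorem kantExp_abs_convergent_log_growth
    (χ f : ℝ → ℝ)
    (hχc : ContinuousOn χ (Set.Ioi 0))
    (C0 C1 : ℝ)
    -- M₀(χ) ≤ C0 < ∞
    (hM0 : ∀ u > (0 : ℝ),
      Summable (fun k : ℤ => |χ (Real.exp (-(k : ℝ)) * u)|) ∧
      (∑' k : ℤ, |χ (Real.exp (-(k : ℝ)) * u)|) ≤ C0)
    -- M₁(χ) ≤ C1 < ∞
    (hM1 : ∀ u > (0 : ℝ),
      Summable (fun k : ℤ =>
        |χ (Real.exp (-(k : ℝ)) * u)| * |(k : ℝ) - Real.log u|) ∧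
      (∑' k : ℤ, |χ (Real.exp (-(k : ℝ)) * u)| * |(k : ℝ) - Real.log u|) ≤ C1)
    (hfm : Measurable f)
    (α β : ℝ) (hα : 0 < α) (hβ : 0 < β)
    (hgrowth : ∀ x > (0 : ℝ), |f x| ≤ α + β * |Real.log x|)
    (x w : ℝ) (hx : 0 < x) (hw : 0 < w) :
    Summable (fun k : ℤ => |χ (Real.exp (-(k : ℝ)) * x ^ w)| *
      (w * ∫ u in ((k : ℝ) / w)..(((k : ℝ) + 1) / w), |f (Real.exp u)|)) ∧
    (∑' k : ℤ, |χ (Real.exp (-(k : ℝ)) * x ^ w)| *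
      (w * ∫ u in ((k : ℝ) / w)..(((k : ℝ) + 1) / w), |f (Real.exp u)|)) ≤
      (α + β * |Real.log x| + β / (2 * w)) * C0 + (β / w) * C1 := by
  have hu : 0 < x ^ w := Real.rpow_pos_of_pos hx w
  obtain ⟨hs0, ht0⟩ := hM0 _ hu
  obtain ⟨hs1, ht1⟩ := hM1 _ hu
  set A := α + β * |Real.log x| + β / (2 * w) with hA
  have hA0 : 0 ≤ A := by positivity
  have hterm : ∀ k : ℤ, |χ (Real.exp (-(k : ℝ)) * x ^ w)| *
      (w * ∫ u in ((k : ℝ) / w)..(((k : ℝ) + 1) / w), |f (Real.exp u)|) ≤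
      A * |χ (Real.exp (-(k : ℝ)) * x ^ w)| + β / w *
        (|χ (Real.exp (-(k : ℝ)) * x ^ w)| * |(k : ℝ) - Real.log (x ^ w)|) := by
    intro k
    have h := mul_le_mul_of_nonneg_left
      (mean_abs_comp_exp_le_of_log_growth hfm hβ.le hgrowth hw k (Real.log x))
      (abs_nonneg (χ (Real.exp (-(k : ℝ)) * x ^ w)))
    rw [Real.log_rpow hx]
    refine h.trans_eq ?_
    rw [hA]
    ring
  have hs := (hs0.mul_left A).add (hs1.mul_left (β / w))
  have hsum := Summable.of_nonneg_of_le (fun k : ℤ => mul_nonneg (abs_nonneg _)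
    (mul_nonneg hw.le (intervalIntegral.integral_nonneg
      (by gcongr; linarith) fun _ _ => abs_nonneg _))) hterm hs
  refine ⟨hsum, (hsum.tsum_le_tsum hterm hs).trans ?_⟩
  rw [(hs0.mul_left A).tsum_add (hs1.mul_left (β / w)), tsum_mul_left, tsum_mul_left]
  gcongr
end

section
/- Let χ: ℝ⁺ → ℝ be a continuous kernel function satisfying ∑_{k=-∞}^{+∞} χ(e^{-k} x^w) = 1 for every x ∈ ℝ⁺ and w > 0, with M₀(χ) < +∞ and M₁(χ) < +∞. Let f: ℝ⁺ → ℝ be bounded and log-uniformly continuous on ℝ⁺. Then for every x ∈ ℝ⁺ and w > 0, |(I_w^χ f)(x) - f(x)| ≤ λ ω(f, 1/w), where λ = M₀(χ) + M₁(χ) and ω(f, δ) is the logarithmic modulus of continuity of f. -/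
open Real MeasureTheory Filter Topology

/-- The logarithmic modulus of continuity
`ω(f, δ) = sup {|f x - f y| : x, y ∈ ℝ⁺, |log x - log y| ≤ δ}`. -/
noncomputable def logModulus (f : ℝ → ℝ) (δ : ℝ) : ℝ :=
  sSup {d : ℝ | ∃ x > (0 : ℝ), ∃ y > (0 : ℝ),
    |Real.log x - Real.log y| ≤ δ ∧ d = |f x - f y|}

/-- If a function oscillates by at most `ω` over distance `1`, it oscillates by at most `n * ω` over
distance `n`. -/
theorem abs_sub_le_nat_mul_of_unit_modulus {G : ℝ → ℝ} {ω : ℝ}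
    (hG : ∀ a b, |a - b| ≤ 1 → |G a - G b| ≤ ω) (n : ℕ) {a b : ℝ} (hab : |a - b| ≤ n) :
    |G a - G b| ≤ n * ω := by
  induction n generalizing a with
  | zero =>
    have h : a = b := by
      rw [Nat.cast_zero] at hab
      exact sub_eq_zero.1 (abs_nonpos_iff.1 hab)
    simp [h]
  | succ n ih =>
    push_cast at hab ⊢
    obtain ⟨c, hac, hcb⟩ : ∃ c, |a - c| ≤ 1 ∧ |c - b| ≤ n := by
      have hn : (0 : ℝ) ≤ n := n.cast_nonneg
      rw [abs_le] at hab
      rcases le_total |a - b| 1 with h | h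
      · exact ⟨b, h, by simp⟩
      · rcases le_abs.1 h with h | h
        · exact ⟨a - 1, by simp, abs_le.2 ⟨by linarith, by linarith⟩⟩
        · exact ⟨a + 1, by simp, abs_le.2 ⟨by linarith, by linarith⟩⟩
    linarith [abs_sub_le (G a) (G c) (G b), hG a c hac, ih hcb]

/-- The mean of `G` over `[k, k + 1]` differs from `G s` by at most `(1 + |k - s|) * ω` when `G`
oscillates by at most `ω` over distance `1`. -/
theorem abs_integral_unit_sub_le {G : ℝ → ℝ} {ω : ℝ} (hGc : Continuous G)
    (hG : ∀ a b, |a - b| ≤ 1 → |G a - G b| ≤ ω) (k s : ℝ) :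
    |(∫ t in k..(k + 1), G t) - G s| ≤ (1 + |k - s|) * ω := by
  have hω : 0 ≤ ω := (abs_nonneg _).trans (hG 0 0 (by simp))
  have hcont : Continuous fun t => G t - G s := hGc.sub continuous_const
  have heq : (∫ t in k..(k + 1), G t) - G s = ∫ t in k..(k + 1), (G t - G s) := by
    rw [intervalIntegral.integral_sub (hGc.intervalIntegrable _ _) (by simp)]
    simp
  have key : ∀ (a b : ℝ) (n : ℕ), a ≤ b → (∀ t, a ≤ t → t ≤ b → |t - s| ≤ n) →
      |∫ t in a..b, (G t - G s)| ≤ n * ω * (b - a) := by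
    intro a b n hab h
    have := intervalIntegral.norm_integral_le_of_norm_le_const (a := a) (b := b) (C := n * ω)
      (f := fun t => G t - G s) fun t ht => by
        rw [Set.uIoc_of_le hab] at ht
        exact abs_sub_le_nat_mul_of_unit_modulus hG n (h t ht.1.le ht.2)
    rwa [Real.norm_eq_abs, abs_of_nonneg (sub_nonneg.2 hab)] at this
  rw [heq]
  rcases le_total k s with hks | hsk
  · rw [abs_of_nonpos (sub_nonpos.2 hks)]
    have hn : (⌊s - k⌋₊ : ℝ) ≤ s - k := Nat.floor_le (sub_nonneg.2 hks)
    have hn' : s - k < ⌊s - k⌋₊ + 1 := Nat.lt_floor_add_one _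
    have h0 : (0 : ℝ) ≤ ⌊s - k⌋₊ := Nat.cast_nonneg _
    refine (key k (k + 1) (⌊s - k⌋₊ + 1) (by linarith) fun t h1 h2 => ?_).trans ?_
    · push_cast
      exact abs_le.2 ⟨by linarith, by linarith⟩
    · push_cast
      nlinarith
  · rw [abs_of_nonneg (sub_nonneg.2 hsk)]
    set n := ⌊k - s⌋₊
    have hn : (n : ℝ) ≤ k - s := Nat.floor_le (sub_nonneg.2 hsk)
    have hn' : k - s < n + 1 := Nat.lt_floor_add_one _
    have h0 : (0 : ℝ) ≤ n := Nat.cast_nonneg _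
    have hleft := key k (s + n + 1) (n + 1) (by linarith) fun t h1 h2 => by
      push_cast
      exact abs_le.2 ⟨by linarith, by linarith⟩
    have hright := key (s + n + 1) (k + 1) (n + 2) (by linarith) fun t h1 h2 => by
      push_cast
      exact abs_le.2 ⟨by linarith, by linarith⟩
    rw [← intervalIntegral.integral_add_adjacent_intervals
      (hcont.intervalIntegrable k (s + n + 1)) (hcont.intervalIntegrable (s + n + 1) (k + 1))]
    refine (abs_add_le _ _).trans ((add_le_add hleft hright).trans (le_of_eq ?_))
    push_cast
    ring

/-- For bounded `f`, the logarithmic modulus of continuity bounds the increments of `f ∘ exp`. -/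
theorem abs_exp_sub_exp_le_logModulus {f : ℝ → ℝ} (hfb : ∃ B : ℝ, ∀ x > (0 : ℝ), |f x| ≤ B)
    {δ a b : ℝ} (hab : |a - b| ≤ δ) :
    |f (Real.exp a) - f (Real.exp b)| ≤ logModulus f δ := by
  obtain ⟨B, hB⟩ := hfb
  refine le_csSup ⟨B + B, ?_⟩
    ⟨_, Real.exp_pos a, _, Real.exp_pos b, by simpa only [Real.log_exp] using hab, rfl⟩
  rintro _ ⟨x, hx, y, hy, -, rfl⟩
  exact (abs_sub _ _).trans (add_le_add (hB x hx) (hB y hy))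

/-- Log-uniform continuity of `f` makes `f ∘ exp` continuous. -/
theorem continuous_comp_exp_of_logUniform {f : ℝ → ℝ}
    (hfu : ∀ ε > (0 : ℝ), ∃ δ > (0 : ℝ), ∀ u > (0 : ℝ), ∀ v > (0 : ℝ),
      |Real.log u - Real.log v| ≤ δ → |f u - f v| < ε) :
    Continuous fun u => f (Real.exp u) := by
  refine Metric.continuous_iff.2 fun b ε hε => ?_
  obtain ⟨δ, hδ, h⟩ := hfu ε hε
  refine ⟨δ, hδ, fun a ha => h _ (Real.exp_pos a) _ (Real.exp_pos b) ?_⟩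
  simpa only [Real.log_exp] using (Real.dist_eq a b ▸ ha).le

/-- Quantitative estimate: `|(I_w^χ f)(x) - f(x)| ≤ (M₀(χ) + M₁(χ)) ω(f, 1/w)`. -/
theorem kantExp_quantitative_estimate
    (χ f : ℝ → ℝ)
    (hχc : ContinuousOn χ (Set.Ioi 0))
    -- (i) partition of unity
    (hχ1 : ∀ x > (0 : ℝ), ∀ w > (0 : ℝ),
      HasSum (fun k : ℤ => χ (Real.exp (-(k : ℝ)) * x ^ w)) 1)
    (C0 C1 : ℝ)
    -- M₀(χ) ≤ C0 < ∞
    (hM0 : ∀ u > (0 : ℝ),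
      Summable (fun k : ℤ => |χ (Real.exp (-(k : ℝ)) * u)|) ∧
      (∑' k : ℤ, |χ (Real.exp (-(k : ℝ)) * u)|) ≤ C0)
    -- M₁(χ) ≤ C1 < ∞
    (hM1 : ∀ u > (0 : ℝ),
      Summable (fun k : ℤ =>
        |χ (Real.exp (-(k : ℝ)) * u)| * |(k : ℝ) - Real.log u|) ∧
      (∑' k : ℤ, |χ (Real.exp (-(k : ℝ)) * u)| * |(k : ℝ) - Real.log u|) ≤ C1)
    -- f bounded
    (hfb : ∃ B : ℝ, ∀ x > (0 : ℝ), |f x| ≤ B)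
    -- f log-uniformly continuous on ℝ⁺
    (hfu : ∀ ε > (0 : ℝ), ∃ δ > (0 : ℝ), ∀ u > (0 : ℝ), ∀ v > (0 : ℝ),
      |Real.log u - Real.log v| ≤ δ → |f u - f v| < ε)
    (x w : ℝ) (hx : 0 < x) (hw : 0 < w) :
    |kantExp χ f w x - f x| ≤ (C0 + C1) * logModulus f (1 / w) := by
  have hmean : ∀ k : ℤ,
      |w * (∫ u in ((k : ℝ) / w)..(((k : ℝ) + 1) / w), f (Real.exp u)) - f x| ≤
        (1 + |(k : ℝ) - Real.log (x ^ w)|) * logModulus f (1 / w) := by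
    intro k
    have h := abs_integral_unit_sub_le (G := fun t => f (Real.exp (t / w)))
      (ω := logModulus f (1 / w))
      ((continuous_comp_exp_of_logUniform hfu).comp (continuous_id.div_const w))
      (fun a b hab => abs_exp_sub_exp_le_logModulus hfb (by
        rw [← sub_div, abs_div, abs_of_pos hw]
        exact div_le_div_of_nonneg_right hab hw.le))
      k (Real.log (x ^ w))
    rw [intervalIntegral.integral_comp_div (fun t => f (Real.exp t)) hw.ne', smul_eq_mul] at h
    rwa [Real.log_rpow hx, mul_div_cancel_left₀ _ hw.ne', Real.exp_log hx,
      ← Real.log_rpow hx] at h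
  have hω : 0 ≤ logModulus f (1 / w) :=
    (abs_nonneg _).trans (abs_exp_sub_exp_le_logModulus (a := 0) (b := 0) (δ := 1 / w) hfb
      (by simp [hw.le]))
  obtain ⟨hs0, hC0⟩ := hM0 (x ^ w) (Real.rpow_pos_of_pos hx w)
  obtain ⟨hs1, hC1⟩ := hM1 (x ^ w) (Real.rpow_pos_of_pos hx w)
  have hbound := (hs0.hasSum.add hs1.hasSum).mul_right (logModulus f (1 / w))
  have hterm : ∀ k : ℤ, ‖χ (Real.exp (-(k : ℝ)) * x ^ w) *
      (w * (∫ u in ((k : ℝ) / w)..(((k : ℝ) + 1) / w), f (Real.exp u)) - f x)‖ ≤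
      (|χ (Real.exp (-(k : ℝ)) * x ^ w)| + |χ (Real.exp (-(k : ℝ)) * x ^ w)| *
        |(k : ℝ) - Real.log (x ^ w)|) * logModulus f (1 / w) := by
    intro k
    rw [Real.norm_eq_abs, abs_mul]
    exact (mul_le_mul_of_nonneg_left (hmean k) (abs_nonneg _)).trans (le_of_eq (by ring))
  have hdiff := (Summable.of_norm_bounded hbound.summable hterm).hasSum
  have hsum := hdiff.add ((hχ1 x hx w hw).mul_right (f x))
  have hkant : kantExp χ f w x - f x = ∑' k : ℤ, χ (Real.exp (-(k : ℝ)) * x ^ w) *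
      (w * (∫ u in ((k : ℝ) / w)..(((k : ℝ) + 1) / w), f (Real.exp u)) - f x) := by
    rw [sub_eq_iff_eq_add, kantExp]
    simpa only [mul_sub, sub_add_cancel, one_mul] using hsum.tsum_eq
  rw [hkant]
  exact (tsum_of_norm_bounded hbound hterm).trans
    (mul_le_mul_of_nonneg_right (add_le_add hC0 hC1) hω)
end

section
/- Let χ: ℝ⁺ → ℝ be a continuous kernel function with M₀(χ) < +∞, let n ∈ ℕ, and let f: ℝ⁺ → ℝ be n times continuously differentiable with θ^(n) f bounded on ℝ⁺. Then for every x ∈ ℝ⁺ and w > 0, the remainder term in the representation formula satisfies |R̂_n^w(x)| ≤ ‖θ^(n) f‖_∞ M₀(χ) / ((n+1)! w^n), where R̂_n^w(x) := (1/n!) ∑_{k ∈ ℤ} χ(e^{-k} x^w) · w ∫_{k/w}^{(k+1)/w} (θ^(n) f)(ξ_{k,u}) (u - k/w)^n du with ξ_{k,u} ∈ (e^{k/w}, e^{(k+1)/w}). -/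
open Real MeasureTheory Filter Topology

/-- Iterates of the Mellin differential operator `(θf)(x) = x f'(x)`:
`θ^(0) f = f`, `θ^(r) f = θ(θ^(r-1) f)`. -/
noncomputable def thetaIter : ℕ → (ℝ → ℝ) → (ℝ → ℝ)
  | 0, f => f
  | n + 1, f => fun x => x * deriv (thetaIter n f) x

/-- A weighted integral of a function bounded by `B` against `(u - a) ^ n` on `[a, b]`. -/
theorem abs_integral_mul_sub_pow_le {g : ℝ → ℝ} {a b B : ℝ} (hab : a ≤ b) (n : ℕ)
    (hg : ∀ u, |g u| ≤ B) :
    |∫ u in a..b, g u * (u - a) ^ n| ≤ B * ((b - a) ^ (n + 1) / (n + 1)) := by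
  have hint : ∫ u in a..b, B * (u - a) ^ n = B * ((b - a) ^ (n + 1) / (n + 1)) := by
    rw [intervalIntegral.integral_const_mul,
      intervalIntegral.integral_comp_sub_right (fun u => u ^ n), integral_pow]
    simp
  rw [← hint, ← Real.norm_eq_abs]
  refine intervalIntegral.norm_integral_le_of_norm_le hab (ae_of_all _ fun u hu => ?_)
    (Continuous.intervalIntegrable (by fun_prop) _ _)
  have hu0 : 0 ≤ (u - a) ^ n := pow_nonneg (sub_nonneg.2 hu.1.le) n
  rw [Real.norm_eq_abs, abs_mul, abs_of_nonneg hu0]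
  exact mul_le_mul_of_nonneg_right (hg u) hu0

/-- Bound for the remainder of the representation formula:
`|R̂_n^w(x)| ≤ ‖θ^(n) f‖_∞ M₀(χ) / ((n+1)! wⁿ)`. -/
theorem kantExp_remainder_bound
    (χ f : ℝ → ℝ)
    (hχc : ContinuousOn χ (Set.Ioi 0))
    (C0 : ℝ)
    -- M₀(χ) ≤ C0 < ∞
    (hM0 : ∀ u > (0 : ℝ),
      Summable (fun k : ℤ => |χ (Real.exp (-(k : ℝ)) * u)|) ∧
      (∑' k : ℤ, |χ (Real.exp (-(k : ℝ)) * u)|) ≤ C0)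
    (n : ℕ)
    -- f is n times continuously differentiable on ℝ⁺
    (hf : ContDiffOn ℝ n f (Set.Ioi 0))
    -- ‖θ^(n) f‖_∞ ≤ B on ℝ⁺
    (B : ℝ) (hB : ∀ x > (0 : ℝ), |thetaIter n f x| ≤ B)
    (x w : ℝ) (hx : 0 < x) (hw : 0 < w)
    -- intermediate points of the Mellin Taylor formula
    (ξ : ℤ → ℝ → ℝ)
    (hξ : ∀ k : ℤ, ∀ u : ℝ,
      ξ k u ∈ Set.Ioo (Real.exp ((k : ℝ) / w)) (Real.exp (((k : ℝ) + 1) / w)))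
    (hξm : ∀ k : ℤ, Measurable fun u : ℝ => thetaIter n f (ξ k u)) :
    |(1 / (Nat.factorial n : ℝ)) *
        ∑' k : ℤ, χ (Real.exp (-(k : ℝ)) * x ^ w) *
          (w * ∫ u in ((k : ℝ) / w)..(((k : ℝ) + 1) / w),
            thetaIter n f (ξ k u) * (u - (k : ℝ) / w) ^ n)| ≤
      B * C0 / ((Nat.factorial (n + 1) : ℝ) * w ^ n) := by
  have hB0 : 0 ≤ B := (abs_nonneg _).trans (hB 1 one_pos)
  obtain ⟨hs, hC⟩ := hM0 (x ^ w) (Real.rpow_pos_of_pos hx w)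
  set D : ℝ := B / ((n + 1 : ℝ) * w ^ n) with hD
  have hD0 : 0 ≤ D := by positivity
  have hterm : ∀ k : ℤ, ‖χ (Real.exp (-(k : ℝ)) * x ^ w) *
      (w * ∫ u in ((k : ℝ) / w)..(((k : ℝ) + 1) / w),
        thetaIter n f (ξ k u) * (u - (k : ℝ) / w) ^ n)‖ ≤
      |χ (Real.exp (-(k : ℝ)) * x ^ w)| * D := by
    intro k
    have hI := abs_integral_mul_sub_pow_le (g := fun u => thetaIter n f (ξ k u)) (B := B)
      (a := (k : ℝ) / w) (b := ((k : ℝ) + 1) / w) (by gcongr; linarith) n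
      (fun u => hB _ ((Real.exp_pos _).trans (hξ k u).1))
    rw [Real.norm_eq_abs, abs_mul, abs_mul, abs_of_pos hw]
    refine mul_le_mul_of_nonneg_left ((mul_le_mul_of_nonneg_left hI hw.le).trans_eq ?_)
      (abs_nonneg _)
    rw [hD, show ((k : ℝ) + 1) / w - k / w = 1 / w by ring, one_div, inv_pow]
    field_simp
    ring
  have hsum := tsum_of_norm_bounded (hs.mul_right D).hasSum hterm
  rw [tsum_mul_right, Real.norm_eq_abs] at hsum
  rw [abs_mul, abs_of_nonneg (by positivity : (0 : ℝ) ≤ 1 / (Nat.factorial n : ℝ))]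
  calc _ ≤ 1 / (Nat.factorial n : ℝ) * (C0 * D) := by
        gcongr
        exact hsum.trans (mul_le_mul_of_nonneg_right hC hD0)
    _ = _ := by
        rw [hD, Nat.factorial_succ]
        push_cast
        field_simp
end

section
/- Let χ: ℝ⁺ → ℝ be a continuous kernel function satisfying: (i) ∑_{k=-∞}^{+∞} χ(e^{-k} x^w) = 1 for every x ∈ ℝ⁺ and w > 0; (ii) M₂(χ) < +∞ and lim_{γ→+∞} ∑_{|k - log u| > γ} |χ(e^{-k} u)| |k - log u|² = 0 uniformly in u ∈ ℝ⁺; and assume the first order moment m₁(χ, u) = 0 for all u ∈ ℝ⁺. Suppose f: ℝ⁺ → ℝ is bounded, twice continuously differentiable, and satisfies ‖I_w^χ f - f‖_∞ = o(w^{-1}) as w → ∞ (i.e., lim_{w→∞} w ‖I_w^χ f - f‖_∞ = 0). Then f is constant on ℝ⁺. -/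
open Real MeasureTheory Filter Topology

/-- A bounded `C²` function on `ℝ` satisfies a quadratic first-order Taylor bound around each
point, uniformly on the whole line. -/
theorem exists_quadratic_taylor_bound {g : ℝ → ℝ} (hg : ContDiff ℝ 2 g) {B : ℝ}
    (hB : ∀ u, |g u| ≤ B) (t : ℝ) :
    ∃ C, ∀ u, |g u - (g t + deriv g t * (u - t))| ≤ C * (u - t) ^ 2 := by
  have hdiff : Differentiable ℝ g := hg.differentiable (by norm_num)
  have hd : DifferentiableAt ℝ (deriv g) t :=
    ((contDiff_succ_iff_deriv (n := 1)).1 hg).2.2.differentiable (by norm_num) t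
  obtain ⟨L, hL⟩ := hd.isBigO_sub.bound
  obtain ⟨δ, hδ, hball⟩ := Metric.eventually_nhds_iff.1 hL
  have hB0 : 0 ≤ B := (abs_nonneg _).trans (hB t)
  refine ⟨|L| + (2 * B / δ ^ 2 + |deriv g t| / δ), fun u => ?_⟩
  have hnear : 0 ≤ |L| * (u - t) ^ 2 := by positivity
  have hfar : 0 ≤ (2 * B / δ ^ 2 + |deriv g t| / δ) * (u - t) ^ 2 := by positivity
  rw [add_mul]
  rcases lt_or_ge |u - t| δ with h | h
  · have key := (convex_uIcc t u).norm_image_sub_le_of_norm_hasDerivWithin_le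
      (f := fun v => g v - deriv g t * v) (f' := fun v => deriv g v - deriv g t)
      (C := |L| * |u - t|) (x := t) (y := u)
      (fun v _ => ((hdiff v).hasDerivAt.sub
        (by simpa using (hasDerivAt_id v).const_mul (deriv g t))).hasDerivWithinAt)
      (fun v hv => by
        have hvt : |v - t| ≤ |u - t| := Set.abs_sub_left_of_mem_uIcc hv
        refine (hball (by rw [Real.dist_eq]; linarith)).trans ?_
        rw [Real.norm_eq_abs]
        exact mul_le_mul (le_abs_self L) hvt (abs_nonneg _) (abs_nonneg _))
      Set.left_mem_uIcc Set.right_mem_uIcc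
    rw [Real.norm_eq_abs, Real.norm_eq_abs, mul_assoc, ← sq, sq_abs] at key
    rw [show g u - (g t + deriv g t * (u - t))
      = g u - deriv g t * u - (g t - deriv g t * t) by ring]
    linarith
  · have h1 : |g u - (g t + deriv g t * (u - t))| ≤ 2 * B + |deriv g t| * |u - t| := by
      rw [← abs_mul]
      have := abs_sub (g u) (g t + deriv g t * (u - t))
      have := abs_add_le (g t) (deriv g t * (u - t))
      linarith [hB u, hB t]
    have h2 : 1 ≤ |u - t| / δ := (one_le_div hδ).2 h
    have h3 : (2 * B / δ ^ 2 + |deriv g t| / δ) * (u - t) ^ 2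
        = 2 * B * (|u - t| / δ) ^ 2 + |deriv g t| * (|u - t| * (|u - t| / δ)) := by
      rw [← sq_abs (u - t)]; ring
    have h4 : 2 * B * 1 ≤ 2 * B * (|u - t| / δ) ^ 2 := by
      gcongr; exact one_le_pow₀ h2
    have h5 : |deriv g t| * (|u - t| * 1) ≤ |deriv g t| * (|u - t| * (|u - t| / δ)) := by
      gcongr
    linarith

/-- The mean of `g` over `[k / w, (k + 1) / w]` differs from the mean of its affine
approximation at `t` by `O(w⁻²)`, with quadratic growth in `k - w t`. -/
theorem abs_mean_sub_affine_le {g : ℝ → ℝ} (hg : Continuous g) {t d C w : ℝ} (hw : 0 < w)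
    (hC : ∀ u, |g u - (g t + d * (u - t))| ≤ C * (u - t) ^ 2) (k : ℝ) :
    |w * (∫ u in (k / w)..((k + 1) / w), g u) - (g t + d * ((k - w * t + 1 / 2) / w))|
      ≤ C / w ^ 2 * (2 * (k - w * t) ^ 2 + 2) := by
  have hC0 : 0 ≤ C := by simpa using (abs_nonneg _).trans (hC (t + 1))
  have haff : ∫ u in (k / w)..((k + 1) / w), (g t + d * (u - t))
      = (g t + d * ((k - w * t + 1 / 2) / w)) / w := by
    rw [intervalIntegral.integral_add (by simp) (Continuous.intervalIntegrable (by fun_prop) _ _),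
      intervalIntegral.integral_const_mul, intervalIntegral.integral_sub (by simp) (by simp),
      integral_id, intervalIntegral.integral_const, intervalIntegral.integral_const]
    simp only [smul_eq_mul]
    field_simp
    ring
  have hrem : |∫ u in (k / w)..((k + 1) / w), (g u - (g t + d * (u - t)))|
      ≤ C / w ^ 2 * (2 * (k - w * t) ^ 2 + 2) * |(k + 1) / w - k / w| := by
    rw [← Real.norm_eq_abs]
    refine intervalIntegral.norm_integral_le_of_norm_le_const fun u hu =>
      (Real.norm_eq_abs _).trans_le ((hC u).trans ?_)
    rw [Set.uIoc_of_le (by gcongr; linarith), Set.mem_Ioc, div_lt_iff₀ hw, le_div_iff₀ hw] at hu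
    have : (w * (u - t)) ^ 2 ≤ 2 * (k - w * t) ^ 2 + 2 := by
      have h1 : 0 ≤ u * w - k := by linarith
      have h2 : u * w - k ≤ 1 := by linarith
      nlinarith [sq_nonneg ((k - w * t) - (u * w - k))]
    calc C * (u - t) ^ 2 = C / w ^ 2 * (w * (u - t)) ^ 2 := by field_simp
      _ ≤ _ := by gcongr
  rw [intervalIntegral.integral_sub (hg.intervalIntegrable _ _)
    (Continuous.intervalIntegrable (by fun_prop) _ _), haff,
    show (k + 1) / w - k / w = 1 / w by ring, abs_of_pos (by positivity : 0 < 1 / w)] at hrem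
  calc _ = w * |(∫ u in (k / w)..((k + 1) / w), g u)
        - (g t + d * ((k - w * t + 1 / 2) / w)) / w| := by
        rw [← abs_of_pos hw, ← abs_mul, abs_of_pos hw]; congr 1; field_simp
    _ ≤ w * (C / w ^ 2 * (2 * (k - w * t) ^ 2 + 2) * (1 / w)) := by gcongr
    _ = _ := by field_simp

/-- The sum of a two-sided sequence is invariant under integer shifts. -/
theorem hasSum_comp_sub_int {a : ℤ → ℝ} (ha : Summable a) (m : ℤ) :
    HasSum (fun k : ℤ => a (k - m)) (∑' k, a k) :=
  (Equiv.subRight m).hasSum_iff.2 ha.hasSum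

/-- Quantitative Voronovskaja estimate for the Kantorovich exponential sampling series at
`x = e^t`, along those `w` for which `w t` is an integer `m`. -/
theorem abs_kantExp_sub_voronovskaja_le {χ f : ℝ → ℝ}
    (h0 : HasSum (fun k : ℤ => χ (Real.exp (-(k : ℝ)))) 1)
    (h1 : HasSum (fun k : ℤ => χ (Real.exp (-(k : ℝ))) * k) 0)
    (h2 : Summable fun k : ℤ => |χ (Real.exp (-(k : ℝ)))| * (k : ℝ) ^ 2)
    (hg : Continuous fun u => f (Real.exp u)) {t d C w : ℝ} (hw : 0 < w)
    (hC : ∀ u, |f (Real.exp u) - (f (Real.exp t) + d * (u - t))| ≤ C * (u - t) ^ 2)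
    {m : ℤ} (hm : w * t = m) :
    |kantExp χ f w (Real.exp t) - (f (Real.exp t) + d / (2 * w))|
      ≤ C / w ^ 2 * ∑' k : ℤ, |χ (Real.exp (-(k : ℝ)))| * (2 * (k : ℝ) ^ 2 + 2) := by
  obtain ⟨b, hb⟩ : ∃ b : ℤ → ℝ, ∀ k, b k = χ (Real.exp (-(k : ℝ))) := ⟨_, fun _ => rfl⟩
  simp only [← hb] at h0 h1 h2 ⊢
  have harg (k : ℤ) : χ (Real.exp (-(k : ℝ)) * Real.exp t ^ w) = b (k - m) := by
    rw [← Real.exp_mul, ← Real.exp_add, mul_comm t, hm, hb]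
    push_cast
    ring_nf
  have hK : Summable fun k : ℤ => |b k| * (2 * (k : ℝ) ^ 2 + 2) :=
    ((h2.mul_left 2).add (h0.summable.abs.mul_left 2)).congr fun k => by ring
  have hmain : HasSum (fun k : ℤ => b (k - m) *
      (f (Real.exp t) + d * (((k : ℝ) - w * t + 1 / 2) / w))) (f (Real.exp t) + d / (2 * w)) := by
    have h := (h0.mul_right (f (Real.exp t) + d / (2 * w))).add (h1.mul_right (d / w))
    rw [← (Equiv.subRight m).hasSum_iff] at h
    rw [one_mul, zero_mul, add_zero] at h
    refine (congrArg (HasSum · _) (funext fun k => ?_)).mpr h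
    simp only [Function.comp_apply, Equiv.subRight_apply, hm]
    push_cast
    field_simp
    ring
  have hbound (k : ℤ) : |b (k - m) * (w * ∫ u in ((k : ℝ) / w)..(((k : ℝ) + 1) / w),
        f (Real.exp u)) - b (k - m) * (f (Real.exp t) + d * (((k : ℝ) - w * t + 1 / 2) / w))|
      ≤ C / w ^ 2 * (|b (k - m)| * (2 * ((k - m : ℤ) : ℝ) ^ 2 + 2)) := by
    rw [← mul_sub, abs_mul, mul_left_comm]
    have := abs_mean_sub_affine_le hg hw hC k
    rw [hm] at this ⊢
    push_cast
    gcongr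
  have hKm := (hasSum_comp_sub_int hK m).mul_left (C / w ^ 2)
  have hdiff := Summable.of_norm_bounded hKm.summable fun k => (Real.norm_eq_abs _).trans_le (hbound k)
  have hkant : Summable fun k : ℤ => b (k - m) *
      (w * ∫ u in ((k : ℝ) / w)..(((k : ℝ) + 1) / w), f (Real.exp u)) :=
    (hdiff.add hmain.summable).congr fun k => by ring
  have heq : kantExp χ f w (Real.exp t) = ∑' k : ℤ, b (k - m) *
      (w * ∫ u in ((k : ℝ) / w)..(((k : ℝ) + 1) / w), f (Real.exp u)) :=
    tsum_congr fun k => by rw [harg]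
  rw [heq, ← hmain.tsum_eq, ← hkant.tsum_sub hmain.summable]
  exact tsum_of_norm_bounded hKm fun k => (Real.norm_eq_abs _).trans_le (hbound k)

/-- Every real number has arbitrarily large positive multipliers turning it into an integer. -/
theorem exists_pos_forall_nat_mul_eq_int (t : ℝ) :
    ∃ c > (0 : ℝ), ∀ n : ℕ, ∃ m : ℤ, (n * c) * t = m := by
  rcases lt_trichotomy t 0 with h | rfl | h
  · exact ⟨-t⁻¹, by simpa using h, fun n => ⟨-n, by have := h.ne; push_cast; field_simp⟩⟩
  · exact ⟨1, one_pos, fun n => ⟨0, by simp⟩⟩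
  · exact ⟨t⁻¹, by positivity, fun n => ⟨n, by push_cast; field_simp⟩⟩

/-- Inverse result: if `‖I_w^χ f - f‖_∞ = o(w⁻¹)` as `w → ∞`, then `f` is constant
on `ℝ⁺`. -/
theorem kantExp_inverse_result
    (χ f : ℝ → ℝ)
    (hχc : ContinuousOn χ (Set.Ioi 0))
    -- (i) partition of unity
    (hχ1 : ∀ x > (0 : ℝ), ∀ w > (0 : ℝ),
      HasSum (fun k : ℤ => χ (Real.exp (-(k : ℝ)) * x ^ w)) 1)
    -- (ii) M₂(χ) < ∞
    (hM2 : ∃ C : ℝ, ∀ u > (0 : ℝ),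
      Summable (fun k : ℤ =>
        |χ (Real.exp (-(k : ℝ)) * u)| * |(k : ℝ) - Real.log u| ^ 2) ∧
      (∑' k : ℤ, |χ (Real.exp (-(k : ℝ)) * u)| * |(k : ℝ) - Real.log u| ^ 2) ≤ C)
    -- (ii) uniform vanishing of the tails of the second absolute moment
    (htail : ∀ ε > (0 : ℝ), ∃ γ₀ : ℝ, ∀ γ ≥ γ₀, ∀ u > (0 : ℝ),
      (∑' k : {k : ℤ // γ < |(k : ℝ) - Real.log u|},
        |χ (Real.exp (-((k : ℤ) : ℝ)) * u)| * |((k : ℤ) : ℝ) - Real.log u| ^ 2) < ε)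
    -- first order algebraic moment m₁(χ, u) vanishes for all u ∈ ℝ⁺
    (hm1 : ∀ u > (0 : ℝ),
      HasSum (fun k : ℤ => χ (Real.exp (-(k : ℝ)) * u) * ((k : ℝ) - Real.log u)) 0)
    -- f bounded and twice continuously differentiable on ℝ⁺
    (hfb : ∃ B : ℝ, ∀ x > (0 : ℝ), |f x| ≤ B)
    (hf : ContDiffOn ℝ 2 f (Set.Ioi 0))
    -- ‖I_w^χ f - f‖_∞ = o(w⁻¹) as w → ∞
    (hsmall : ∀ ε > (0 : ℝ), ∃ w₀ : ℝ, ∀ w ≥ w₀, ∀ x > (0 : ℝ),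
      w * |kantExp χ f w x - f x| ≤ ε) :
    ∀ x > (0 : ℝ), ∀ y > (0 : ℝ), f x = f y := by
  obtain ⟨B, hB⟩ := hfb
  have hg : ContDiff ℝ 2 fun u => f (Real.exp u) :=
    contDiffOn_univ.1 (hf.comp Real.contDiff_exp.contDiffOn fun u _ => Real.exp_pos u)
  have h0 : HasSum (fun k : ℤ => χ (Real.exp (-(k : ℝ)))) 1 := by
    simpa using hχ1 1 one_pos 1 one_pos
  have h1 : HasSum (fun k : ℤ => χ (Real.exp (-(k : ℝ))) * k) 0 := by
    simpa using hm1 1 one_pos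
  have h2 : Summable fun k : ℤ => |χ (Real.exp (-(k : ℝ)))| * (k : ℝ) ^ 2 := by
    obtain ⟨_, hM⟩ := hM2
    simpa using (hM 1 one_pos).1
  have hderiv (t : ℝ) : deriv (fun u => f (Real.exp u)) t = 0 := by
    obtain ⟨C, hC⟩ := exists_quadratic_taylor_bound hg (fun u => hB _ (Real.exp_pos u)) t
    set d := deriv (fun u => f (Real.exp u)) t
    obtain ⟨c, hc, hint⟩ := exists_pos_forall_nat_mul_eq_int t
    set K := ∑' k : ℤ, |χ (Real.exp (-(k : ℝ)))| * (2 * (k : ℝ) ^ 2 + 2)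
    have hw : Tendsto (fun n : ℕ => (n : ℝ) * c) atTop atTop :=
      tendsto_natCast_atTop_atTop.atTop_mul_const hc
    suffices |d / 2| ≤ 0 by simpa using this
    refine le_of_forall_pos_le_add fun ε hε => ?_
    obtain ⟨w₀, hw₀⟩ := hsmall ε hε
    have hlim : Tendsto (fun n : ℕ => ε + C * K / ((n : ℝ) * c)) atTop (𝓝 (0 + ε)) := by
      simpa using (hw.const_div_atTop (C * K)).const_add ε
    refine ge_of_tendsto hlim ?_
    filter_upwards [hw.eventually_ge_atTop w₀, hw.eventually_gt_atTop 0] with n hn hpos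
    obtain ⟨m, hm⟩ := hint n
    have hsm := hw₀ _ hn _ (Real.exp_pos t)
    have hV := abs_kantExp_sub_voronovskaja_le h0 h1 h2 hg.continuous hpos hC hm
    set w := (n : ℝ) * c
    set D := kantExp χ f w (Real.exp t) - f (Real.exp t)
    calc |d / 2| = w * |d / (2 * w)| := by
          rw [← abs_of_pos hpos, ← abs_mul, abs_of_pos hpos]; congr 1; field_simp
      _ = w * |D - (kantExp χ f w (Real.exp t) - (f (Real.exp t) + d / (2 * w)))| := by
          congr 2; ring
      _ ≤ w * (|D| + C / w ^ 2 * K) := by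
          gcongr; exact (abs_sub _ _).trans (by gcongr)
      _ = w * |D| + C * K / w := by field_simp
      _ ≤ ε + C * K / w := by gcongr
  intro x hx y hy
  have := is_const_of_deriv_eq_zero (hg.differentiable (by norm_num)) hderiv
    (Real.log x) (Real.log y)
  simpa [Real.exp_log hx, Real.exp_log hy] using this
end
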